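/- arXiv:2504.11772 — 3 statements merged into one kernel-verified Lean document; each statement's English description precedes it below -/
import Mathlib

section
/- Let S be a triangulated category with a classical generator G, i.e. S = ⟨G⟩. Then for every triangulated endofunctor F : S → S there exists an integer l ≥ 0 such that F(⟨G⟩^{(-∞,-(i+l)]}) ⊆ ⟨G⟩^{(-∞,-i]} and F(⟨G⟩^{[i+l,∞)}) ⊆ ⟨G⟩^{[i,∞)} for all i ∈ ℤ. Consequently, when S = T^c for a compactly generated triangulated category T, the finite generating sequences 𝒢 given by 𝒢^n = {Σ^{-n}G} and 𝒢' given by 𝒢'^n = {Σ^n G} are ℕ-compressed. -/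
open CategoryTheory Limits Pretriangulated

universe v u

namespace Paper

variable (C : Type u) [Category.{v} C] [HasZeroObject C] [Preadditive C]
  [HasShift C ℤ] [∀ n : ℤ, (CategoryTheory.shiftFunctor C n).Additive] [Pretriangulated C]

variable {C}

/-- The right orthogonal of a class of objects. -/
def rOrth (S : Set C) : Set C := {X | ∀ ⦃A : C⦄, A ∈ S → ∀ f : A ⟶ X, f = 0}

/-- The left orthogonal of a class of objects. -/
def lOrth (S : Set C) : Set C := {X | ∀ ⦃A : C⦄, A ∈ S → ∀ f : X ⟶ A, f = 0}

/-- `star S T` is the class of objects `Y` admitting a distinguished triangle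
`A ⟶ Y ⟶ B ⟶ A⟦1⟧` with `A ∈ S` and `B ∈ T`. -/
def star (S T : Set C) : Set C :=
  {Y | ∃ (A B : C) (_ : A ∈ S) (_ : B ∈ T) (f : A ⟶ Y) (g : Y ⟶ B) (h : B ⟶ A⟦(1 : ℤ)⟧),
    Triangle.mk f g h ∈ distTriang C}

/-- The closure of a class of objects under finite coproducts and extensions
(equivalently, the smallest class containing `S` and all zero objects which is closed
under extensions). -/
inductive coprodClosure (S : Set C) : C → Prop
  | of {X : C} (hX : X ∈ S) : coprodClosure S X
  | zero {X : C} (hX : IsZero X) : coprodClosure S X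
  | ext {T : Triangle C} (hT : T ∈ distTriang C)
      (h₁ : coprodClosure S T.obj₁) (h₃ : coprodClosure S T.obj₃) : coprodClosure S T.obj₂

/-- The closure of a class of objects under direct summands (retracts). -/
def smd (S : Set C) : Set C :=
  {X | ∃ (Y : C) (_ : Y ∈ S) (i : X ⟶ Y) (r : Y ⟶ X), i ≫ r = 𝟙 X}

/-- The objects isomorphic to `Σ^{-i} G = G⟦-i⟧` for some `i ∈ I`. -/
def shiftSet (G : C) (I : Set ℤ) : Set C := {X | ∃ i ∈ I, Nonempty (X ≅ G⟦(-i : ℤ)⟧)}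

/-- `⟨G⟩^{I}` : summands of finite extensions of the shifts `Σ^{-i}G`, `i ∈ I`. -/
def genInt (G : C) (I : Set ℤ) : Set C := smd (setOf (coprodClosure (shiftSet G I)))

/-- The thick subcategory `⟨G⟩ = ∪_n ⟨G⟩^{[-n,n]}` generated by `G`. -/
def thickGen (G : C) : Set C := ⋃ n : ℕ, genInt G (Set.Icc (-(n : ℤ)) (n : ℤ))

/-- The closure of the union of a sequence of classes under finite coproducts, extensions
and direct summands; `𝒢^{I}` in the paper. -/
def seqInt (𝒢 : ℤ → Set C) (I : Set ℤ) : Set C :=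
  smd (setOf (coprodClosure (⋃ i ∈ I, 𝒢 i)))

section Coproducts

variable [HasCoproducts.{v} C]

/-- An object `G` is compact if every morphism from `G` to a coproduct factors through
a finite subcoproduct. -/
def IsCompactObj (G : C) : Prop :=
  ∀ ⦃α : Type v⦄ (f : α → C) (φ : G ⟶ ∐ f),
    ∃ (s : Finset α) (ψ : G ⟶ ∐ (fun i : s => f i)),
      φ = ψ ≫ Sigma.desc (fun i => Sigma.ι f i.1)

/-- The class of compact objects, `T^c`. -/
def compacts : Set C := {X | IsCompactObj X}

/-- `G` is a single compact generator of `T`. -/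
structure IsSingleCompactGenerator (G : C) : Prop where
  compact : IsCompactObj G
  generates : ∀ X : C, (∀ n : ℤ, ∀ f : G⟦n⟧ ⟶ X, f = 0) → IsZero X

/-- The closure of a class of objects under arbitrary (small) coproducts and extensions. -/
inductive bigClosure (S : Set C) : C → Prop
  | of {X : C} (hX : X ∈ S) : bigClosure S X
  | zero {X : C} (hX : IsZero X) : bigClosure S X
  | coprod {α : Type v} (f : α → C) (hf : ∀ a, bigClosure S (f a)) : bigClosure S (∐ f)
  | ext {T : Triangle C} (hT : T ∈ distTriang C)
      (h₁ : bigClosure S T.obj₁) (h₃ : bigClosure S T.obj₃) : bigClosure S T.obj₂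

/-- `Coprod(S)`, the closure of `S` under arbitrary coproducts and extensions. -/
def CoprodSet (S : Set C) : Set C := setOf (bigClosure S)

/-- `⟨G⟩̄^{I}` : summands of objects obtained from the shifts `Σ^{-i}G`, `i ∈ I`,
by arbitrary coproducts and extensions. -/
def genIntBig (G : C) (I : Set ℤ) : Set C := smd (CoprodSet (shiftSet G I))

end Coproducts

/-- A (strictly full) triangulated subcategory, as a class of objects. -/
structure IsTriangSub (S : Set C) : Prop where
  zero : ∀ X : C, IsZero X → X ∈ S
  isoClosed : ∀ {X Y : C}, (X ≅ Y) → X ∈ S → Y ∈ S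
  shift : ∀ X ∈ S, ∀ n : ℤ, X⟦n⟧ ∈ S
  ext : ∀ T ∈ distTriang C, T.obj₁ ∈ S → T.obj₃ ∈ S → T.obj₂ ∈ S

/-- The smallest strictly full triangulated subcategory containing `S`. -/
inductive triangClosure (S : Set C) : C → Prop
  | of {X : C} (hX : X ∈ S) : triangClosure S X
  | zero {X : C} (hX : IsZero X) : triangClosure S X
  | shift {X : C} (n : ℤ) (hX : triangClosure S X) : triangClosure S (X⟦n⟧)
  | ext {T : Triangle C} (hT : T ∈ distTriang C)
      (h₁ : triangClosure S T.obj₁) (h₃ : triangClosure S T.obj₃) : triangClosure S T.obj₂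

/-- A semiorthogonal decomposition `⟨A, B⟩` of the (triangulated) subcategory `D`:
`A` and `B` are strictly full triangulated subcategories of `D`, there are no nonzero
morphisms from objects of `B` to objects of `A`, and together they generate `D`. -/
structure IsSOD (D A B : Set C) : Prop where
  subsetA : A ⊆ D
  subsetB : B ⊆ D
  triangA : IsTriangSub A
  triangB : IsTriangSub B
  hom_zero : ∀ b ∈ B, ∀ a ∈ A, ∀ f : b ⟶ a, f = 0
  generates : setOf (triangClosure (A ∪ B)) = D

end Paper

namespace Paper

section CompactGeneration

/-- The quiver underlying a category, reached directly rather than through `ReflQuiver`, so that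
the simplifier recognises the types of morphisms. -/
local instance quiverOfCategory {C : Type u} [Category.{v} C] : Quiver.{v} C :=
  CategoryStruct.toQuiver

open scoped ZeroObject

section Triangles

variable {C : Type u} [Category.{v} C] [HasZeroObject C] [Preadditive C]
  [HasShift C ℤ] [∀ n : ℤ, (CategoryTheory.shiftFunctor C n).Additive] [Pretriangulated C]
  {A Y B A' Y' B' X : C} {f : A ⟶ Y} {g : Y ⟶ B} {h : B ⟶ A⟦(1 : ℤ)⟧}
  {f' : A' ⟶ Y'} {g' : Y' ⟶ B'} {h' : B' ⟶ A'⟦(1 : ℤ)⟧}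

lemma exists_hom_left (hT : Triangle.mk f g h ∈ distTriang C)
    (hT' : Triangle.mk f' g' h' ∈ distTriang C) (b : Y ⟶ Y') (c : B ⟶ B')
    (w : g ≫ c = b ≫ g') : ∃ a : A ⟶ A', f ≫ b = a ≫ f' ∧ h ≫ a⟦(1 : ℤ)⟧' = c ≫ h' :=
  complete_distinguished_triangle_morphism₁ _ _ hT hT' b c w

lemma exists_hom_mid (hT : Triangle.mk f g h ∈ distTriang C)
    (hT' : Triangle.mk f' g' h' ∈ distTriang C) (a : A ⟶ A') (c : B ⟶ B')
    (w : h ≫ a⟦(1 : ℤ)⟧' = c ≫ h') : ∃ b : Y ⟶ Y', f ≫ b = a ≫ f' ∧ g ≫ c = b ≫ g' :=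
  complete_distinguished_triangle_morphism₂ _ _ hT hT' a c w

lemma exists_hom_right (hT : Triangle.mk f g h ∈ distTriang C)
    (hT' : Triangle.mk f' g' h' ∈ distTriang C) (a : A ⟶ A') (b : Y ⟶ Y')
    (w : f ≫ b = a ≫ f') : ∃ c : B ⟶ B', g ≫ c = b ≫ g' ∧ h ≫ a⟦(1 : ℤ)⟧' = c ≫ h' :=
  complete_distinguished_triangle_morphism _ _ hT hT' a b w

lemma exists_lift₂ (hT : Triangle.mk f g h ∈ distTriang C) (u : X ⟶ Y) (hu : u ≫ g = 0) :
    ∃ w : X ⟶ A, u = w ≫ f :=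
  Triangle.coyoneda_exact₂ _ hT u hu

lemma exists_lift₃ (hT : Triangle.mk f g h ∈ distTriang C) (u : X ⟶ B) (hu : u ≫ h = 0) :
    ∃ w : X ⟶ Y, u = w ≫ g :=
  Triangle.coyoneda_exact₃ _ hT u hu

lemma exists_desc₃ (hT : Triangle.mk f g h ∈ distTriang C) (u : B ⟶ X) (hu : g ≫ u = 0) :
    ∃ w : A⟦(1 : ℤ)⟧ ⟶ X, u = h ≫ w :=
  Triangle.yoneda_exact₃ _ hT u hu

lemma comp_zero₁₂ (hT : Triangle.mk f g h ∈ distTriang C) : f ≫ g = 0 :=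
  comp_distTriang_mor_zero₁₂ _ hT

lemma comp_zero₂₃ (hT : Triangle.mk f g h ∈ distTriang C) : g ≫ h = 0 :=
  comp_distTriang_mor_zero₂₃ _ hT

lemma comp_zero₃₁ (hT : Triangle.mk f g h ∈ distTriang C) : h ≫ f⟦(1 : ℤ)⟧' = 0 :=
  comp_distTriang_mor_zero₃₁ _ hT

end Triangles

section Extensions

variable {C : Type u} [Category.{v} C] [HasZeroObject C] [Preadditive C]
  [HasShift C ℤ] [∀ n : ℤ, (CategoryTheory.shiftFunctor C n).Additive] [Pretriangulated C]

lemma subset_smd (S : Set C) : S ⊆ smd S := fun X hX => ⟨X, hX, 𝟙 X, 𝟙 X, by simp⟩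

lemma mem_smd_of_retract {S : Set C} {X Y : C} (i : X ⟶ Y) (r : Y ⟶ X) (h : i ≫ r = 𝟙 X)
    (hY : Y ∈ smd S) : X ∈ smd S := by
  obtain ⟨Z, hZ, i', r', h'⟩ := hY
  exact ⟨Z, hZ, i ≫ i', r' ≫ r, by simp [reassoc_of% h', h]⟩

lemma mem_smd_of_iso {S : Set C} {X Y : C} (e : X ≅ Y) (hY : Y ∈ smd S) : X ∈ smd S :=
  mem_smd_of_retract e.hom e.inv (by simp) hY

/-- The summands of objects of an extension-closed class form an extension-closed class. -/
lemma smd_coprodClosure_ext (S : Set C) {T : Triangle C} (hT : T ∈ distTriang C)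
    (h₁ : T.obj₁ ∈ smd (setOf (coprodClosure S))) (h₃ : T.obj₃ ∈ smd (setOf (coprodClosure S))) :
    T.obj₂ ∈ smd (setOf (coprodClosure S)) := by
  obtain ⟨A, hA, i, r, hir⟩ := h₁
  obtain ⟨B, hB, j, s, hjs⟩ := h₃
  obtain ⟨Y, f, g, hT'⟩ := distinguished_cocone_triangle₂ (s ≫ T.mor₃ ≫ i⟦(1 : ℤ)⟧')
  have hir' : i⟦(1 : ℤ)⟧' ≫ r⟦(1 : ℤ)⟧' = 𝟙 _ := by
    rw [← Functor.map_comp, hir, CategoryTheory.Functor.map_id]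
  obtain ⟨a, ha₁, ha₂⟩ := exists_hom_mid (h := T.mor₃) hT hT' i j
    (by simp [reassoc_of% hjs])
  obtain ⟨b, hb₁, hb₂⟩ := exists_hom_mid (h' := T.mor₃) hT' hT r s
    (by simp [hir'])
  let φ : T ⟶ T :=
    { hom₁ := 𝟙 _
      hom₂ := a ≫ b
      hom₃ := 𝟙 _
      comm₁ := by rw [reassoc_of% ha₁, hb₁, reassoc_of% hir]; simp
      comm₂ := by rw [Category.assoc, ← hb₂, ← reassoc_of% ha₂, hjs]
      comm₃ := by simp }
  have hφ : IsIso (a ≫ b) := isIso₂_of_isIso₁₃ φ hT hT (inferInstanceAs (IsIso (𝟙 _)))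
    (inferInstanceAs (IsIso (𝟙 _)))
  exact ⟨Y, coprodClosure.ext hT' hA hB, a, b ≫ inv (a ≫ b), by
    rw [← Category.assoc, IsIso.hom_inv_id]⟩

lemma genInt_zero (G : C) (I : Set ℤ) {X : C} (hX : IsZero X) : X ∈ genInt G I :=
  subset_smd _ (coprodClosure.zero hX)

lemma shift_mem_genInt (G : C) {I : Set ℤ} {i : ℤ} (hi : i ∈ I) : G⟦(-i : ℤ)⟧ ∈ genInt G I :=
  subset_smd _ (coprodClosure.of ⟨i, hi, ⟨Iso.refl _⟩⟩)

lemma genInt_ext (G : C) (I : Set ℤ) {T : Triangle C} (hT : T ∈ distTriang C)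
    (h₁ : T.obj₁ ∈ genInt G I) (h₃ : T.obj₃ ∈ genInt G I) : T.obj₂ ∈ genInt G I :=
  smd_coprodClosure_ext _ hT h₁ h₃

/-- A class closed under retracts and extensions which contains the zero objects and the relevant
shifts of `G` contains `⟨G⟩^I`. -/
lemma genInt_induction {G : C} {I : Set ℤ} {P : C → Prop}
    (shift : ∀ i ∈ I, P (G⟦(-i : ℤ)⟧)) (zero : ∀ X, IsZero X → P X)
    (ext : ∀ T ∈ distTriang C, P T.obj₁ → P T.obj₃ → P T.obj₂)
    (retract : ∀ {X Y : C} (i : X ⟶ Y) (r : Y ⟶ X), i ≫ r = 𝟙 X → P Y → P X)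
    {X : C} (hX : X ∈ genInt G I) : P X := by
  obtain ⟨Y, hY, i, r, hir⟩ := hX
  refine retract i r hir ?_
  clear hir r i
  induction hY with
  | of h =>
    obtain ⟨i, hi, ⟨e⟩⟩ := h
    exact retract e.hom e.inv (by simp) (shift i hi)
  | zero h => exact zero _ h
  | ext hT _ _ h₁ h₃ => exact ext _ hT h₁ h₃

lemma genInt_mono (G : C) {I J : Set ℤ} (h : I ⊆ J) : genInt G I ⊆ genInt G J := fun _ hX =>
  genInt_induction (P := fun X => X ∈ genInt G J) (fun _ hi => shift_mem_genInt G (h hi))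
    (fun _ => genInt_zero G J) (fun _ hT => genInt_ext G J hT) mem_smd_of_retract hX

lemma shift_genInt (G : C) {I J : Set ℤ} (k : ℤ) (h : ∀ i ∈ I, i - k ∈ J) {X : C}
    (hX : X ∈ genInt G I) : X⟦k⟧ ∈ genInt G J := by
  refine genInt_induction (P := fun X => X⟦k⟧ ∈ genInt G J) ?_ ?_ ?_ ?_ hX
  · intro i hi
    exact mem_smd_of_iso ((shiftFunctorAdd' C (-i) k (-(i - k)) (by ring)).app G).symm
      (shift_mem_genInt G (h i hi))
  · intro X hX
    exact genInt_zero G J ((shiftFunctor C k).map_isZero hX)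
  · intro T hT h₁ h₃
    exact genInt_ext G J (Triangle.shift_distinguished T hT k) h₁ h₃
  · intro X Y i r h hY
    exact mem_smd_of_retract (i⟦k⟧') (r⟦k⟧')
      (by rw [← Functor.map_comp, h, CategoryTheory.Functor.map_id]) hY

/-- A triangulated functor sending `G` into `⟨G⟩^K` sends `⟨G⟩^I` into `⟨G⟩^J` when
`I + K ⊆ J`. -/
lemma obj_mem_genInt {G : C} (F : C ⥤ C) [F.CommShift ℤ] [F.IsTriangulated] {K I J : Set ℤ}
    (hG : F.obj G ∈ genInt G K) (h : ∀ i ∈ I, ∀ k ∈ K, k + i ∈ J) {X : C}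
    (hX : X ∈ genInt G I) : F.obj X ∈ genInt G J := by
  refine genInt_induction (P := fun X => F.obj X ∈ genInt G J) ?_ ?_ ?_ ?_ hX
  · intro i hi
    refine mem_smd_of_iso ((F.commShiftIso (-i : ℤ)).app G) (shift_genInt G (-i) (I := K) ?_ hG)
    intro k hk
    simpa using h i hi k hk
  · intro X hX
    exact genInt_zero G J (F.map_isZero hX)
  · intro T hT h₁ h₃
    exact genInt_ext G J (F.map_distinguished T hT) h₁ h₃
  · intro X Y i r h hY
    exact mem_smd_of_retract (F.map i) (F.map r) (by rw [← Functor.map_comp, h, CategoryTheory.Functor.map_id]) hY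

/-- A triangulated endofunctor is bounded with respect to `⟨G⟩^{(-∞,-n]}` and `⟨G⟩^{[n,∞)}` as
soon as it sends `G` into the thick subcategory generated by `G`. -/
lemma exists_bound_of_obj_mem_thickGen {G : C} (F : C ⥤ C) [F.CommShift ℤ] [F.IsTriangulated]
    (hG : F.obj G ∈ thickGen G) :
    ∃ l : ℕ, ∀ i : ℤ,
      (∀ X ∈ genInt G (Set.Iic (-(i + l))), F.obj X ∈ genInt G (Set.Iic (-i))) ∧
      (∀ X ∈ genInt G (Set.Ici (i + l)), F.obj X ∈ genInt G (Set.Ici i)) := by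
  obtain ⟨n, hn⟩ := Set.mem_iUnion.1 hG
  refine ⟨n, fun i => ⟨fun X hX => obj_mem_genInt F hn ?_ hX,
    fun X hX => obj_mem_genInt F hn ?_ hX⟩⟩
  · intro a ha k hk
    simp only [Set.mem_Iic, Set.mem_Icc] at *
    lia
  · intro a ha k hk
    simp only [Set.mem_Ici, Set.mem_Icc] at *
    lia

lemma genInt_univ_subset_thickGen (G : C) : genInt G Set.univ ⊆ thickGen G := by
  have mono {m n : ℕ} (h : m ≤ n) : genInt G (Set.Icc (-(m : ℤ)) m) ⊆
      genInt G (Set.Icc (-(n : ℤ)) n) := genInt_mono G (Set.Icc_subset_Icc (by lia) (by lia))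
  intro X hX
  refine genInt_induction (P := fun X => X ∈ thickGen G) ?_ ?_ ?_ ?_ hX
  · intro i _
    exact Set.mem_iUnion.2 ⟨i.natAbs, shift_mem_genInt G (by rw [Set.mem_Icc]; lia)⟩
  · intro X hX
    exact Set.mem_iUnion.2 ⟨0, genInt_zero _ _ hX⟩
  · intro T hT h₁ h₃
    obtain ⟨m, hm⟩ := Set.mem_iUnion.1 h₁
    obtain ⟨n, hn⟩ := Set.mem_iUnion.1 h₃
    exact Set.mem_iUnion.2 ⟨max m n, genInt_ext G _ hT (mono (le_max_left m n) hm)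
      (mono (le_max_right m n) hn)⟩
  · intro X Y i r h hY
    obtain ⟨n, hn⟩ := Set.mem_iUnion.1 hY
    exact Set.mem_iUnion.2 ⟨n, mem_smd_of_retract i r h hn⟩

lemma mem_rOrth_genInt {G : C} {I : Set ℤ} {H : C}
    (hH : ∀ i ∈ I, ∀ f : G⟦(-i : ℤ)⟧ ⟶ H, f = 0) : H ∈ rOrth (genInt G I) := by
  intro A hA
  refine genInt_induction (P := fun A => ∀ f : A ⟶ H, f = 0) hH ?_ ?_ ?_ hA
  · intro X hX f
    exact hX.eq_of_src _ _
  · intro T hT h₁ h₃ f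
    obtain ⟨g, rfl⟩ := Triangle.yoneda_exact₂ T hT f (h₁ _)
    rw [h₃ g, comp_zero]
  · intro X Y i r h hY f
    rw [← Category.id_comp f, ← h, Category.assoc, hY (r ≫ f), comp_zero]

end Extensions

section Compactness

variable {C : Type u} [Category.{v} C] [HasZeroObject C] [Preadditive C]
  [HasShift C ℤ] [∀ n : ℤ, (CategoryTheory.shiftFunctor C n).Additive] [Pretriangulated C]
  [HasCoproducts.{v} C]

open Classical in
/-- The idempotent of a coproduct projecting onto a finite subcoproduct. -/
noncomputable def finProj {α : Type v} (f : α → C) (s : Finset α) : ∐ f ⟶ ∐ f :=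
  ∑ a ∈ s, Sigma.π f a ≫ Sigma.ι f a

lemma ι_finProj_of_mem {α : Type v} (f : α → C) {s : Finset α} {a : α} (ha : a ∈ s) :
    Sigma.ι f a ≫ finProj f s = Sigma.ι f a := by
  classical
  rw [finProj, Preadditive.comp_sum, Finset.sum_eq_single a]
  · simp
  · intro b _ hb
    rw [Sigma.ι_π_of_ne_assoc _ hb.symm, zero_comp]
  · exact fun h => (h ha).elim

lemma ι_finProj_of_notMem {α : Type v} (f : α → C) {s : Finset α} {a : α} (ha : a ∉ s) :
    Sigma.ι f a ≫ finProj f s = 0 := by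
  classical
  rw [finProj, Preadditive.comp_sum]
  refine Finset.sum_eq_zero fun b hb => ?_
  rw [Sigma.ι_π_of_ne_assoc _ (by rintro rfl; exact ha hb), zero_comp]

lemma finProj_comp_of_subset {α : Type v} (f : α → C) {s t : Finset α} (h : s ⊆ t) :
    finProj f s ≫ finProj f t = finProj f s := by
  classical
  rw [finProj, Preadditive.sum_comp]
  refine Finset.sum_congr rfl fun a ha => ?_
  rw [Category.assoc, ι_finProj_of_mem f (h ha)]

lemma isCompactObj_iff (A : C) : IsCompactObj A ↔
    ∀ ⦃α : Type v⦄ (f : α → C) (u : A ⟶ ∐ f), ∃ s : Finset α, u ≫ finProj f s = u := by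
  classical
  constructor
  · intro h α f u
    obtain ⟨s, ψ, rfl⟩ := h f u
    refine ⟨s, ?_⟩
    rw [Category.assoc]
    congr 1
    refine Sigma.hom_ext _ _ fun a => ?_
    rw [Sigma.ι_desc_assoc, Sigma.ι_desc, ι_finProj_of_mem f a.2]
  · intro h α f u
    obtain ⟨s, hs⟩ := h f u
    refine ⟨s, u ≫ ∑ a ∈ s.attach, Sigma.π f a.1 ≫ Sigma.ι (fun i : s => f i) a, ?_⟩
    conv_lhs => rw [← hs]
    rw [Category.assoc, finProj, Preadditive.sum_comp, ← Finset.sum_attach]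
    congr 1
    refine Finset.sum_congr rfl fun a _ => ?_
    rw [Category.assoc, Sigma.ι_desc]

lemma IsCompactObj.ext {T : Triangle C} (hT : T ∈ distTriang C) (h₁ : IsCompactObj T.obj₁)
    (h₃ : IsCompactObj T.obj₃) : IsCompactObj T.obj₂ := by
  classical
  rw [isCompactObj_iff] at *
  intro α f u
  obtain ⟨s, hs⟩ := h₁ f (T.mor₁ ≫ u)
  obtain ⟨w, hw⟩ := Triangle.yoneda_exact₂ T hT (u - u ≫ finProj f s) (by
    rw [Preadditive.comp_sub, ← Category.assoc, hs, sub_self])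
  obtain ⟨t, ht⟩ := h₃ f w
  refine ⟨s ∪ t, ?_⟩
  have hu : u = u ≫ finProj f s + T.mor₂ ≫ w ≫ finProj f t := by rw [ht, ← hw]; abel
  conv_lhs => rw [hu]
  simp only [Preadditive.add_comp, Category.assoc,
    finProj_comp_of_subset f Finset.subset_union_left,
    finProj_comp_of_subset f Finset.subset_union_right]
  exact hu.symm

lemma IsCompactObj.retract {X Y : C} (i : X ⟶ Y) (r : Y ⟶ X) (h : i ≫ r = 𝟙 X)
    (hY : IsCompactObj Y) : IsCompactObj X := by
  rw [isCompactObj_iff] at *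
  intro α f u
  obtain ⟨s, hs⟩ := hY f (r ≫ u)
  refine ⟨s, ?_⟩
  have := i ≫= hs
  rwa [Category.assoc, reassoc_of% h, reassoc_of% h] at this

lemma isCompactObj_of_isZero {X : C} (hX : IsZero X) : IsCompactObj X :=
  (isCompactObj_iff X).2 fun _ _ _ => ⟨∅, hX.eq_of_src _ _⟩

lemma IsCompactObj.shift {A : C} (hA : IsCompactObj A) (n : ℤ) : IsCompactObj (A⟦n⟧) := by
  rw [isCompactObj_iff] at *
  intro α f u
  let e := PreservesCoproduct.iso (shiftFunctor C (-n)) f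
  have he (a : α) : (Sigma.ι f a)⟦-n⟧' ≫ e.hom = Sigma.ι (fun a => (f a)⟦-n⟧) a := by
    rw [← Iso.eq_comp_inv, PreservesCoproduct.inv_hom, ι_comp_sigmaComparison]
  have hp (s : Finset α) : finProj (fun a => (f a)⟦-n⟧) s ≫ e.inv =
      e.inv ≫ (finProj f s)⟦-n⟧' := by
    refine Sigma.hom_ext _ _ fun a => ?_
    rw [← he, Category.assoc, Category.assoc, e.hom_inv_id_assoc, ← Functor.map_comp,
      reassoc_of% (he a)]
    by_cases ha : a ∈ s
    · rw [ι_finProj_of_mem f ha, reassoc_of% (ι_finProj_of_mem (fun a => (f a)⟦-n⟧) ha), ← he,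
        Category.assoc, e.hom_inv_id, Category.comp_id]
    · rw [ι_finProj_of_notMem f ha, reassoc_of% (ι_finProj_of_notMem (fun a => (f a)⟦-n⟧) ha),
        zero_comp, Functor.map_zero]
  obtain ⟨s, hs⟩ := hA _ ((shiftShiftNeg A n).inv ≫ u⟦-n⟧' ≫ e.hom)
  refine ⟨s, (shiftFunctor C (-n)).map_injective ?_⟩
  have := hs =≫ e.inv
  simp only [Category.assoc, hp, e.hom_inv_id_assoc, e.hom_inv_id, Category.comp_id,
    Iso.cancel_iso_inv_left] at this
  rw [Functor.map_comp, this]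

lemma IsCompactObj.obj₁ {T : Triangle C} (hT : T ∈ distTriang C) (h₂ : IsCompactObj T.obj₂)
    (h₃ : IsCompactObj T.obj₃) : IsCompactObj T.obj₁ :=
  IsCompactObj.ext (inv_rot_of_distTriang _ hT) (h₃.shift (-1)) h₂

lemma genInt_subset_compacts {G : C} (hG : IsCompactObj G) (I : Set ℤ) :
    genInt G I ⊆ compacts := fun _ hX =>
  genInt_induction (P := IsCompactObj) (fun i _ => hG.shift (-i))
    (fun _ => isCompactObj_of_isZero) (fun _ hT => IsCompactObj.ext hT) IsCompactObj.retract hX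

end Compactness

section Factorization

variable {C : Type u} [Category.{v} C] [HasZeroObject C] [Preadditive C]
  [HasShift C ℤ] [∀ n : ℤ, (CategoryTheory.shiftFunctor C n).Additive] [Pretriangulated C]

/-- The morphism `u` factors through an object of the closure of `S` under finite coproducts and
extensions. -/
def FactorsThru (S : Set C) {X Y : C} (u : X ⟶ Y) : Prop :=
  ∃ (Q : C) (_ : coprodClosure S Q) (a : X ⟶ Q) (b : Q ⟶ Y), a ≫ b = u

lemma FactorsThru.comp_right {S : Set C} {X Y Z : C} {u : X ⟶ Y} (h : FactorsThru S u)
    (w : Y ⟶ Z) : FactorsThru S (u ≫ w) := by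
  obtain ⟨Q, hQ, a, b, rfl⟩ := h
  exact ⟨Q, hQ, a, b ≫ w, by simp⟩

lemma FactorsThru.zero (S : Set C) (X Y : C) : FactorsThru S (0 : X ⟶ Y) :=
  ⟨(0 : C), coprodClosure.zero (isZero_zero C), 0, 0, by simp⟩

lemma FactorsThru.add {S : Set C} {X Y : C} {u w : X ⟶ Y} (hu : FactorsThru S u)
    (hw : FactorsThru S w) : FactorsThru S (u + w) := by
  obtain ⟨Q, hQ, a, b, rfl⟩ := hu
  obtain ⟨Q', hQ', a', b', rfl⟩ := hw
  exact ⟨Q ⊞ Q', coprodClosure.ext (binaryBiproductTriangle_distinguished Q Q') hQ hQ',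
    biprod.lift a a', biprod.desc b b', by simp⟩

lemma FactorsThru.sum {S : Set C} {X Y : C} {α : Type*} (s : Finset α) (u : α → (X ⟶ Y))
    (h : ∀ a ∈ s, FactorsThru S (u a)) : FactorsThru S (∑ a ∈ s, u a) := by
  classical
  induction s using Finset.induction_on with
  | empty => simpa using FactorsThru.zero S X Y
  | insert a s ha ih =>
    rw [Finset.sum_insert ha]
    exact (h a (Finset.mem_insert_self a s)).add
      (ih fun b hb => h b (Finset.mem_insert_of_mem hb))

variable [HasCoproducts.{v} C]

lemma isCompactObj_of_coprodClosure {S : Set C} (hS : S ⊆ compacts) {X : C}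
    (hX : coprodClosure S X) : IsCompactObj X := by
  induction hX with
  | of h => exact hS h
  | zero h => exact isCompactObj_of_isZero h
  | ext hT _ _ h₁ h₃ => exact IsCompactObj.ext hT h₁ h₃

/-- Objects all of whose morphisms from a compact object factor through the closure of `S` under
finite coproducts and extensions. -/
def compactlyFactoring (S : Set C) : Set C :=
  {Y | ∀ ⦃K : C⦄, IsCompactObj K → ∀ u : K ⟶ Y, FactorsThru S u}

lemma coprod_mem_compactlyFactoring {S : Set C} {α : Type v} (f : α → C) (hf : ∀ a, f a ∈ S) :
    ∐ f ∈ compactlyFactoring S := by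
  classical
  intro K hK u
  obtain ⟨s, hs⟩ := (isCompactObj_iff K).1 hK f u
  rw [← hs, finProj, Preadditive.comp_sum]
  exact FactorsThru.sum _ _ fun a _ =>
    ⟨f a, coprodClosure.of (hf a), u ≫ Sigma.π f a, Sigma.ι f a, by simp⟩

lemma compactlyFactoring_ext {S : Set C} (hS : S ⊆ compacts) {T : Triangle C}
    (hT : T ∈ distTriang C) (h₁ : T.obj₁ ∈ compactlyFactoring S)
    (h₃ : T.obj₃ ∈ compactlyFactoring S) : T.obj₂ ∈ compactlyFactoring S := by
  intro K hK u
  obtain ⟨P, hP, a, b, hab⟩ := h₃ hK (u ≫ T.mor₂)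
  obtain ⟨D, d, e, hD⟩ := distinguished_cocone_triangle₁ a
  obtain ⟨x, -, hx⟩ := exists_hom_left (h' := T.mor₃) hD hT u b hab
  obtain ⟨Q, hQ, p, q, rfl⟩ := h₁
    (IsCompactObj.obj₁ hD hK (isCompactObj_of_coprodClosure hS hP)) x
  obtain ⟨E, i, j, hE⟩ := distinguished_cocone_triangle₂ (e ≫ p⟦(1 : ℤ)⟧')
  obtain ⟨m, -, hm⟩ := exists_hom_mid (h' := T.mor₃) hE hT q b
    (((Category.assoc _ _ _).trans
      (congrArg (e ≫ ·) ((shiftFunctor C (1 : ℤ)).map_comp p q).symm)).trans hx)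
  obtain ⟨n, -, hn⟩ := exists_hom_mid hD hE p (𝟙 P)
    (by simp)
  obtain ⟨w, hw⟩ := Triangle.coyoneda_exact₂ T hT (u - n ≫ m) (by
    rw [Preadditive.sub_comp, Category.assoc, ← hm, ← reassoc_of% hn, ← hab]
    simp)
  have hu : u = n ≫ m + w ≫ T.mor₁ := by rw [← hw]; abel
  rw [hu]
  exact FactorsThru.add ⟨E, coprodClosure.ext hE hQ hP, n, m, rfl⟩
    ((h₁ hK w).comp_right T.mor₁)

end Factorization

section Telescope

variable {C : Type u} [Category.{v} C] [HasZeroObject C] [Preadditive C]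
  [HasShift C ℤ] [∀ n : ℤ, (CategoryTheory.shiftFunctor C n).Additive] [Pretriangulated C]
  [HasCoproducts.{v} C]

/-- The homotopy colimit of a sequence: if every morphism from each of the compact objects `A i`
to a term of the sequence dies in the next term, then no `A i` maps nontrivially to the homotopy
colimit, while a compatible family of morphisms from a compact object `K` which dies in the
homotopy colimit dies at some finite level. -/
lemma exists_telescope (X : ℕ → C) (x : ∀ n, X n ⟶ X (n + 1)) :
    ∃ (H : C) (p : X 0 ⟶ H),
      (∀ A : C, IsCompactObj A → (∀ n (f : A ⟶ X n), f ≫ x n = 0) → ∀ f : A ⟶ H, f = 0) ∧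
      (∀ K : C, IsCompactObj K → ∀ c : ∀ n, K ⟶ X n, (∀ n, c n ≫ x n = c (n + 1)) →
        c 0 ≫ p = 0 → ∃ n, c n = 0) := by
  classical
  let f : ULift.{v} ℕ → C := fun n => X n.down
  let ι (n : ℕ) : X n ⟶ ∐ f := Sigma.ι f ⟨n⟩
  let π (n : ℕ) : ∐ f ⟶ X n := Sigma.π f ⟨n⟩
  have ιπ (n : ℕ) : ι n ≫ π n = 𝟙 _ := Sigma.ι_π_eq_id f ⟨n⟩
  have ιπ_ne {m n : ℕ} (h : m ≠ n) : ι m ≫ π n = 0 :=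
    Sigma.ι_π_of_ne f (fun h' => h (congrArg ULift.down h'))
  have ext {Z : C} {g h : ∐ f ⟶ Z} (hgh : ∀ n, ι n ≫ g = ι n ≫ h) : g = h :=
    Sigma.hom_ext _ _ fun n => hgh n.down
  let σ : ∐ f ⟶ ∐ f := Sigma.desc fun n => x n.down ≫ ι (n.down + 1)
  have ισ (n : ℕ) : ι n ≫ σ = x n ≫ ι (n + 1) := Sigma.ι_desc _ _
  have σπ (n : ℕ) : σ ≫ π (n + 1) = π n ≫ x n := by
    refine ext fun m => ?_
    rw [reassoc_of% (ισ m)]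
    by_cases h : m = n
    · subst h
      rw [ιπ, reassoc_of% (ιπ m), Category.comp_id]
    · rw [ιπ_ne (by lia), reassoc_of% (ιπ_ne h), comp_zero, zero_comp]
  have σπ_zero : σ ≫ π 0 = 0 := by
    refine ext fun m => ?_
    rw [reassoc_of% (ισ m), ιπ_ne (by lia), comp_zero, comp_zero]
  have supp {A : C} (hA : IsCompactObj A) (u : A ⟶ ∐ f) :
      ∃ s : Finset (ULift.{v} ℕ), u = ∑ n ∈ s, (u ≫ π n.down) ≫ ι n.down := by
    obtain ⟨s, hs⟩ := (isCompactObj_iff A).1 hA f u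
    refine ⟨s, ?_⟩
    conv_lhs => rw [← hs, finProj, Preadditive.comp_sum]
    refine Finset.sum_congr rfl fun n _ => ?_
    rw [← Category.assoc]
    congr!
  obtain ⟨H, p, δ, hT⟩ := distinguished_cocone_triangle (𝟙 _ - σ)
  have hp : σ ≫ p = p := by
    have := comp_zero₁₂ hT
    rw [Preadditive.sub_comp, Category.id_comp, sub_eq_zero] at this
    exact this.symm
  refine ⟨H, ι 0 ≫ p, ?_, ?_⟩
  · intro A hA hAx u
    have inj : ∀ w : A⟦(-1 : ℤ)⟧ ⟶ ∐ f, w ≫ (𝟙 _ - σ) = 0 → w = 0 := by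
      intro w hw
      rw [Preadditive.comp_sub, Category.comp_id, sub_eq_zero] at hw
      have hπ (n : ℕ) : w ≫ π n = 0 := by
        induction n with
        | zero => rw [hw, Category.assoc, σπ_zero, comp_zero]
        | succ n ih => rw [hw, Category.assoc, σπ, reassoc_of% ih, zero_comp]
      obtain ⟨s, hs⟩ := supp (hA.shift (-1)) w
      rw [hs]
      exact Finset.sum_eq_zero fun n _ => by rw [hπ, zero_comp]
    have huδ : u ≫ δ = 0 := by
      have hδ : (u ≫ δ)⟦(-1 : ℤ)⟧' ≫ (shiftShiftNeg (∐ f) (1 : ℤ)).hom = 0 := by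
        refine inj _ ?_
        have hd := comp_zero₃₁ hT
        have nat := (shiftFunctorCompIsoId C (1 : ℤ) (-1) (by simp)).hom.naturality (𝟙 _ - σ)
        dsimp at nat
        rw [Category.assoc]
        erw [← nat]
        rw [← Functor.map_comp_assoc, Category.assoc, hd, comp_zero, Functor.map_zero, zero_comp]
      refine (shiftFunctor C (-1 : ℤ)).map_injective ?_
      rw [Functor.map_zero, ← cancel_mono (shiftShiftNeg (∐ f) (1 : ℤ)).hom, hδ, zero_comp]
    obtain ⟨w, rfl⟩ := exists_lift₃ hT u huδ
    obtain ⟨s, hs⟩ := supp hA w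
    rw [hs, Preadditive.sum_comp]
    refine Finset.sum_eq_zero fun n _ => ?_
    rw [← hp, Category.assoc, reassoc_of% (ισ n.down), ← Category.assoc,
      hAx n.down (w ≫ π n.down), zero_comp]
  · intro K hK c hc h0
    obtain ⟨w, hw⟩ := exists_lift₂ hT (c 0 ≫ ι 0) (by simpa using h0)
    rw [Preadditive.comp_sub, Category.comp_id] at hw
    have hwc (n : ℕ) : w ≫ π n = c n := by
      induction n with
      | zero =>
        have := hw =≫ π 0
        rw [Preadditive.sub_comp, Category.assoc, Category.assoc, ιπ, σπ_zero, comp_zero,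
          sub_zero, Category.comp_id] at this
        exact this.symm
      | succ n ih =>
        have := hw =≫ π (n + 1)
        rw [Preadditive.sub_comp, Category.assoc, Category.assoc, ιπ_ne (by lia), σπ,
          reassoc_of% ih, hc, comp_zero] at this
        exact (sub_eq_zero.1 this.symm)
    obtain ⟨s, hs⟩ := supp hK w
    obtain ⟨N, hN⟩ := Infinite.exists_notMem_finset s
    refine ⟨N.down, ?_⟩
    rw [← hwc, hs, Preadditive.sum_comp]
    refine Finset.sum_eq_zero fun n hn => ?_
    rw [Category.assoc, ιπ_ne (fun h => hN (by rwa [← ULift.ext _ _ h])), comp_zero]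

end Telescope

section Approximation

variable {C : Type u} [Category.{v} C] [HasZeroObject C] [Preadditive C]
  [HasShift C ℤ] [∀ n : ℤ, (CategoryTheory.shiftFunctor C n).Additive] [Pretriangulated C]
  [HasCoproducts.{v} C]

/-- A distinguished triangle `fib ⟶ K ⟶ cof ⟶ fib⟦1⟧` whose first term lies in
`compactlyFactoring S`. -/
structure Approximation (S : Set C) (K : C) where
  /-- the fibre of `toCof` -/
  fib : C
  /-- the cofibre of `fromFib` -/
  cof : C
  /-- the morphism from the fibre -/
  fromFib : fib ⟶ K
  /-- the morphism to the cofibre -/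
  toCof : K ⟶ cof
  /-- the connecting morphism -/
  δ : cof ⟶ fib⟦(1 : ℤ)⟧
  mem : Triangle.mk fromFib toCof δ ∈ distTriang C
  fib_mem : fib ∈ compactlyFactoring S

lemma exists_approximation (S : Set C) (K : C) : Nonempty (Approximation S K) :=
  ⟨{ fib := 0
     cof := K
     fromFib := 0
     toCof := 𝟙 K
     δ := 0
     mem := contractible_distinguished₁ K
     fib_mem := fun X _ u => by
      rw [(isZero_zero C).eq_of_tgt u 0]
      exact FactorsThru.zero S X 0 }⟩

/-- An approximation can be improved so that all morphisms from the objects `g i` to the old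
cofibre die in the new one. -/
lemma Approximation.exists_next {ι : Type} (g : ι → C) {S : Set C} (hS : S ⊆ compacts)
    (hg : ∀ i, g i ∈ S) {K : C} (s : Approximation S K) :
    ∃ (s' : Approximation S K) (t : s.cof ⟶ s'.cof), s.toCof ≫ t = s'.toCof ∧
      ∀ i (f : g i ⟶ s.cof), f ≫ t = 0 := by
  let P : C := ∐ fun j : (Σ i, (g i ⟶ s.cof)) => g j.1
  let ev : P ⟶ s.cof := Sigma.desc fun j => j.2
  obtain ⟨F, a, b, hF⟩ := distinguished_cocone_triangle₂ (ev ≫ s.δ)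
  have hF' : F ∈ compactlyFactoring S := compactlyFactoring_ext hS hF s.fib_mem
    (coprod_mem_compactlyFactoring _ fun j => hg j.1)
  obtain ⟨k, hk₁, hk₂⟩ := exists_hom_mid hF s.mem (𝟙 _) ev
    (by simp)
  obtain ⟨X, c, d, hX⟩ := distinguished_cocone_triangle k
  obtain ⟨φ, hφ, -⟩ := exists_hom_right s.mem hX a (𝟙 K)
    (by simpa using hk₁.symm)
  have hkc : k ≫ c = 0 := comp_zero₁₂ hX
  obtain ⟨θ, hθ⟩ := exists_desc₃ hF (ev ≫ φ) (by
    rw [reassoc_of% hk₂, hφ, Category.id_comp, hkc])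
  have hcδ : s.toCof ≫ s.δ = 0 := comp_zero₂₃ s.mem
  refine ⟨⟨F, X, k, c, d, hX, hF'⟩, φ - s.δ ≫ θ, ?_, ?_⟩
  · dsimp
    rw [Preadditive.comp_sub, hφ, reassoc_of% hcδ, zero_comp, sub_zero, Category.id_comp]
  · intro i f
    have hf : f = Sigma.ι (fun j : (Σ i, (g i ⟶ s.cof)) => g j.1) ⟨i, f⟩ ≫ ev :=
      (Sigma.ι_desc (fun j : (Σ i, (g i ⟶ s.cof)) => j.2) ⟨i, f⟩).symm
    rw [hf, Category.assoc, Preadditive.comp_sub, hθ, Category.assoc, sub_self, comp_zero]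

/-- A compact object which is left orthogonal to everything right orthogonal to the shifts
`G⟦-i⟧`, `i ∈ I`, of a compact object `G` lies in `⟨G⟩^I`. -/
theorem mem_genInt_of_mem_lOrth {G : C} (hG : IsCompactObj G) (I : Set ℤ) {K : C}
    (hK : IsCompactObj K) (hKI : K ∈ lOrth (rOrth (genInt G I))) : K ∈ genInt G I := by
  let S := shiftSet G I
  have hS : S ⊆ compacts := by
    rintro X ⟨i, _, ⟨e⟩⟩
    exact IsCompactObj.retract e.hom e.inv (by simp) (hG.shift (-i))
  let g : I → C := fun i => G⟦(-i.1 : ℤ)⟧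
  have hg (i : I) : g i ∈ S := ⟨i.1, i.2, ⟨Iso.refl _⟩⟩
  choose next t hc ht using fun s : Approximation S K => s.exists_next g hS hg
  let s (n : ℕ) : Approximation S K :=
    n.rec (exists_approximation S K).some fun _ s => next s
  obtain ⟨H, p, hH, hKp⟩ := exists_telescope (fun n => (s n).cof) (fun n => t (s n))
  have hHI : H ∈ rOrth (genInt G I) := mem_rOrth_genInt fun i hi f =>
    hH _ (hG.shift (-i)) (fun n f => ht (s n) ⟨i, hi⟩ f) f
  obtain ⟨n, hn⟩ := hKp K hK (fun n => (s n).toCof) (fun n => hc (s n)) (hKI hHI _)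
  obtain ⟨r, hr⟩ := exists_lift₂ (s n).mem (𝟙 K) (by simpa using hn)
  obtain ⟨Q, hQ, a, b, rfl⟩ := (s n).fib_mem hK r
  exact ⟨Q, hQ, a, b ≫ (s n).fromFib, by rw [← Category.assoc]; exact hr.symm⟩

lemma lOrth_rOrth_genInt_inter_compacts {G : C} (hG : IsCompactObj G) (I : Set ℤ) :
    lOrth (rOrth (genInt G I)) ∩ compacts = genInt G I :=
  Set.Subset.antisymm (fun _ hX => mem_genInt_of_mem_lOrth hG I hX.2 hX.1)
    (fun _ hX => ⟨fun _ hA f => hA hX f, genInt_subset_compacts hG I hX⟩)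

/-- A single compact generator classically generates the compact objects. -/
theorem IsSingleCompactGenerator.compacts_subset_thickGen {G : C}
    (hG : IsSingleCompactGenerator G) : compacts ⊆ thickGen G := by
  intro K hK
  refine genInt_univ_subset_thickGen G (mem_genInt_of_mem_lOrth hG.compact _ hK ?_)
  intro H hH f
  refine (hG.generates H fun n u => hH ?_ u).eq_of_tgt _ _
  simpa using shift_mem_genInt G (Set.mem_univ (-n))

end Approximation

end CompactGeneration

/-- Let `S` be a triangulated category with a classical generator `G`, i.e. `S = ⟨G⟩`. Then for
every triangulated endofunctor `F : S ⥤ S` there exists `l ≥ 0` with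
`F(⟨G⟩^{(-∞,-(i+l)]}) ⊆ ⟨G⟩^{(-∞,-i]}` and `F(⟨G⟩^{[i+l,∞)}) ⊆ ⟨G⟩^{[i,∞)}` for all `i ∈ ℤ`.
Consequently, when `S = T^c` for a compactly generated triangulated category `T` with a single
compact generator `G`, the finite generating sequences `𝒢ⁿ = {Σ⁻ⁿG}` and `𝒢'ⁿ = {ΣⁿG}` are
`ℕ`-compressed: the metrics `R^𝒢_n ∩ T^c` are `ℕ`-compressed (here triangulated endofunctors
of `T^c` are encoded as triangulated endofunctors of `T` preserving compact objects) and are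
equivalent to the metrics `M^𝒢`. -/
theorem statement_0 :
    (∀ (S : Type u) (_ : Category.{v} S) (_ : HasZeroObject S) (_ : Preadditive S)
      (_ : HasShift S ℤ) (_ : ∀ n : ℤ, (CategoryTheory.shiftFunctor S n).Additive)
      (_ : Pretriangulated S) (G : S), thickGen G = (Set.univ : Set S) →
      ∀ (F : S ⥤ S) [F.CommShift ℤ] [F.IsTriangulated],
        ∃ l : ℕ, ∀ i : ℤ,
          (∀ X ∈ genInt G (Set.Iic (-(i + l))), F.obj X ∈ genInt G (Set.Iic (-i))) ∧
          (∀ X ∈ genInt G (Set.Ici (i + l)), F.obj X ∈ genInt G (Set.Ici i))) ∧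
    (∀ (T : Type u) (_ : Category.{v} T) (_ : HasZeroObject T) (_ : Preadditive T)
      (_ : HasShift T ℤ) (_ : ∀ n : ℤ, (CategoryTheory.shiftFunctor T n).Additive)
      (_ : Pretriangulated T) (_ : HasCoproducts.{v} T) (G : T),
      IsSingleCompactGenerator G →
      -- the generating sequence `𝒢ⁿ = {Σ⁻ⁿ G}`, with `M^𝒢_n = ⟨G⟩^{(-∞,-n]}`,
      -- and the generating sequence `𝒢'ⁿ = {Σⁿ G}`, with `M^𝒢'_n = ⟨G⟩^{[n,∞)}`,
      -- are both `ℕ`-compressed: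
      (∀ M : ℤ → Set T,
        (M = (fun n => genInt G (Set.Iic (-n))) ∨ M = (fun n => genInt G (Set.Ici n))) →
        -- the metric `R^𝒢_n ∩ T^c` is `ℕ`-compressed ...
        ((∀ (F : T ⥤ T) [F.CommShift ℤ] [F.IsTriangulated],
            (∀ X ∈ compacts (C := T), F.obj X ∈ compacts (C := T)) →
            ∃ l : ℕ, ∀ i : ℤ, ∀ X ∈ lOrth (rOrth (M (i + l))) ∩ compacts,
              F.obj X ∈ lOrth (rOrth (M i)) ∩ compacts) ∧
        -- ... and is equivalent to the metric `M^𝒢` on `T^c`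
          (∀ i : ℤ, ∃ j : ℕ,
            M (i + j) ⊆ lOrth (rOrth (M i)) ∩ compacts ∧
            lOrth (rOrth (M i)) ∩ compacts ⊆ M (i - j))))) := by
  refine ⟨?_, ?_⟩
  · intro S _ _ _ _ _ _ G hG F _ _
    exact exists_bound_of_obj_mem_thickGen F (by rw [hG]; trivial)
  · intro T _ _ _ _ _ _ _ G hG M hM
    have hR (n : ℤ) : lOrth (rOrth (M n)) ∩ compacts = M n := by
      rcases hM with rfl | rfl <;> exact lOrth_rOrth_genInt_inter_compacts hG.compact _
    refine ⟨fun F _ _ hF => ?_, fun i => ⟨0, ?_⟩⟩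
    · obtain ⟨l, hl⟩ := exists_bound_of_obj_mem_thickGen F
        (hG.compacts_subset_thickGen (hF G hG.compact))
      refine ⟨l, fun i => ?_⟩
      rw [hR, hR]
      rcases hM with rfl | rfl
      · exact (hl i).1
      · exact (hl i).2
    · simp [hR]

end Paper
end

section
/- Let T be a compactly generated triangulated category with a generating sequence 𝒢 and an orthogonal metric R on T such that for every n ∈ ℤ one has Hom(𝒢^n, R_i) = 0 for all i ≫ 0. Then an object F of T lies in the closure of compacts T̄^c := ∩_{n∈ℤ}(T^c ⋆ R_n) if and only if there exists a sequence E_1 → E_2 → E_3 → ⋯ of compact objects together with compatible maps E_n → F such that Cone(E_n → F) ∈ R_n for all n. Furthermore, for any such sequence the induced map Hocolim E_n → F from the homotopy colimit is an isomorphism. -/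
open CategoryTheory Limits Pretriangulated

universe v u

namespace Paper

variable {C : Type u} [Category.{v} C] [HasZeroObject C] [Preadditive C]
  [HasShift C ℤ] [∀ n : ℤ, (CategoryTheory.shiftFunctor C n).Additive] [Pretriangulated C]

/-- An extended good metric on a triangulated category. -/
structure IsGoodMetric (M : ℤ → Set C) : Prop where
  zero : ∀ n : ℤ, ∀ X : C, IsZero X → X ∈ M n
  isoClosed : ∀ n : ℤ, ∀ {X Y : C}, (X ≅ Y) → X ∈ M n → Y ∈ M n
  antitone : ∀ n : ℤ, M (n + 1) ⊆ M n
  extClosed : ∀ n : ℤ, star (M n) (M n) ⊆ M n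
  shiftDown : ∀ n : ℤ, ∀ X ∈ M (n + 1), X⟦(-1 : ℤ)⟧ ∈ M n
  shiftUp : ∀ n : ℤ, ∀ X ∈ M (n + 1), X⟦(1 : ℤ)⟧ ∈ M n

/-- A good metric is orthogonal if `^⊥((M_n)^⊥) = M_n` for all `n`. -/
def IsOrthogonalMetric (M : ℤ → Set C) : Prop :=
  IsGoodMetric M ∧ ∀ n : ℤ, lOrth (rOrth (M n)) = M n

section Coproducts

variable [HasCoproducts.{v} C]

/-- A generating sequence on a compactly generated triangulated category. -/
structure IsGenSeq (𝒢 : ℤ → Set C) : Prop where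
  subset_compacts : ∀ n : ℤ, 𝒢 n ⊆ compacts
  generates : seqInt 𝒢 Set.univ = compacts
  mem : ∀ n : ℤ, ∀ X ∈ 𝒢 n, X ∈ seqInt 𝒢 (Set.Icc (n - 1) (n + 1))
  shiftUp : ∀ n : ℤ, ∀ X ∈ 𝒢 n, X⟦(1 : ℤ)⟧ ∈ seqInt 𝒢 (Set.Icc (n - 1) (n + 1))
  shiftDown : ∀ n : ℤ, ∀ X ∈ 𝒢 n, X⟦(-1 : ℤ)⟧ ∈ seqInt 𝒢 (Set.Icc (n - 1) (n + 1))

/-- The closure of the compacts `T̄^c = ∩_{n∈ℤ} (T^c ⋆ R_n)` with respect to a metric `R`. -/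
def closureCompacts (R : ℤ → Set C) : Set C :=
  {F | ∀ n : ℤ, F ∈ star (compacts (C := C)) (R n)}

end Coproducts

end Paper

namespace Paper

/-- If `f : X ⟶ Y` is injective on morphisms from a class of objects stable under `⟦-1⟧`, then
so is its shift. -/
lemma shift_hom_eq_zero {C : Type u} [Category.{v} C] [Preadditive C] [HasShift C ℤ]
    [∀ n : ℤ, (CategoryTheory.shiftFunctor C n).Additive]
    {P : Set C} (hP : ∀ K ∈ P, K⟦(-1 : ℤ)⟧ ∈ P) {X Y : C} (f : X ⟶ Y)
    (hf : ∀ K ∈ P, ∀ x : K ⟶ X, x ≫ f = 0 → x = 0) {K : C} (hK : K ∈ P)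
    (x : K ⟶ X⟦(1 : ℤ)⟧) (hx : x ≫ f⟦(1 : ℤ)⟧' = 0) : x = 0 := by
  obtain ⟨y, hy⟩ := (shiftFunctor C (1 : ℤ)).map_surjective ((shiftNegShift K (1 : ℤ)).hom ≫ x)
  have hyf : y ≫ f = 0 := (shiftFunctor C (1 : ℤ)).map_injective (by
    rw [Functor.map_comp, hy, Category.assoc, hx, comp_zero, Functor.map_zero])
  rw [hf _ (hP K hK) y hyf, Functor.map_zero] at hy
  rw [← cancel_epi (shiftNegShift K (1 : ℤ)).hom, ← hy, comp_zero]

variable {C : Type u} [Category.{v} C] [HasZeroObject C] [Preadditive C]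
  [HasShift C ℤ] [∀ n : ℤ, (CategoryTheory.shiftFunctor C n).Additive] [Pretriangulated C]

/-- A finite extension, or a summand of one, of objects that admit no nonzero morphisms to `R i`
for `i ≫ 0` also has this property. -/
lemma eventually_hom_eq_zero {R S : ℤ → Set C} {I : Set ℤ}
    (h : ∀ n : ℤ, ∃ i₀ : ℤ, ∀ i ≥ i₀, ∀ X ∈ S n, ∀ D ∈ R i, ∀ f : X ⟶ D, f = 0)
    {K : C} (hK : K ∈ seqInt S I) :
    ∃ i₀ : ℤ, ∀ i ≥ i₀, ∀ D ∈ R i, ∀ f : K ⟶ D, f = 0 := by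
  obtain ⟨Y, hY, i, r, hir⟩ := hK
  suffices H : ∃ i₀ : ℤ, ∀ i ≥ i₀, ∀ D ∈ R i, ∀ f : Y ⟶ D, f = 0 by
    obtain ⟨i₀, H⟩ := H
    refine ⟨i₀, fun j hj D hD f => ?_⟩
    rw [← Category.id_comp f, ← hir, Category.assoc, H j hj D hD (r ≫ f), comp_zero]
  clear hir i r
  induction hY with
  | of hX =>
    simp only [Set.mem_iUnion] at hX
    obtain ⟨n, _, hX⟩ := hX
    obtain ⟨i₀, H⟩ := h n
    exact ⟨i₀, fun j hj D hD f => H j hj _ hX D hD f⟩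
  | zero hX => exact ⟨0, fun _ _ _ _ f => hX.eq_of_src _ _⟩
  | @ext T hT _ _ ih₁ ih₃ =>
    obtain ⟨i₁, H₁⟩ := ih₁
    obtain ⟨i₃, H₃⟩ := ih₃
    refine ⟨max i₁ i₃, fun j hj D hD f => ?_⟩
    obtain ⟨g, rfl⟩ := Triangle.yoneda_exact₂ T hT f
      (H₁ j (le_trans (le_max_left _ _) hj) D hD _)
    rw [H₃ j (le_trans (le_max_right _ _) hj) D hD g, comp_zero]

section Coproducts

variable [HasCoproducts.{v} C]

/-- A morphism from a compact object to a coproduct is a finite sum of morphisms to the summands. -/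
lemma exists_eq_sum_of_mem_compacts {K : C} (hK : K ∈ compacts) {α : Type v}
    (f : α → C) (x : K ⟶ ∐ f) :
    ∃ (s : Finset α) (y : ∀ a, K ⟶ f a), x = ∑ a ∈ s, y a ≫ Sigma.ι f a := by
  classical
  obtain ⟨s, ψ, hψ⟩ := hK f x
  have hid : 𝟙 (∐ fun i : s => f i) =
      ∑ i : s, Sigma.π (fun i : s => f i) i ≫ Sigma.ι (fun i : s => f i) i := by
    refine Sigma.hom_ext _ _ fun j => ?_
    rw [Category.comp_id, Preadditive.comp_sum, Finset.sum_eq_single j]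
    · simp
    · intro b _ hb
      rw [Sigma.ι_π_of_ne_assoc _ hb.symm, zero_comp]
    · simp
  refine ⟨s, fun a => if h : a ∈ s then ψ ≫ Sigma.π (fun i : s => f i) ⟨a, h⟩ else 0, ?_⟩
  rw [hψ, ← Category.id_comp (Sigma.desc _), hid, ← Finset.sum_coe_sort s,
    Preadditive.sum_comp, Preadditive.comp_sum]
  exact Finset.sum_congr rfl fun i _ => by simp

lemma mem_compacts_of_exists_eq_sum {K : C}
    (hK : ∀ ⦃α : Type v⦄ (f : α → C) (x : K ⟶ ∐ f),
      ∃ (s : Finset α) (y : ∀ a, K ⟶ f a), x = ∑ a ∈ s, y a ≫ Sigma.ι f a) :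
    K ∈ compacts := by
  intro α f x
  obtain ⟨s, y, hy⟩ := hK f x
  refine ⟨s, ∑ i : s, y i ≫ Sigma.ι (fun i : s => f i) i, ?_⟩
  rw [hy, ← Finset.sum_coe_sort s, Preadditive.sum_comp]
  exact Finset.sum_congr rfl fun i _ => by simp

lemma shift_mem_compacts {K : C} (hK : K ∈ compacts) (n : ℤ) :
    K⟦n⟧ ∈ compacts := by
  refine mem_compacts_of_exists_eq_sum fun α f x => ?_
  obtain ⟨s, y, hy⟩ := exists_eq_sum_of_mem_compacts hK (fun a => (f a)⟦-n⟧)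
    ((shiftShiftNeg K n).inv ≫ x⟦-n⟧' ≫
      (PreservesCoproduct.iso (shiftFunctor C (-n)) f).hom)
  choose z hz using fun a =>
    (shiftFunctor C (-n)).map_surjective ((shiftShiftNeg K n).hom ≫ y a)
  refine ⟨s, z, (shiftFunctor C (-n)).map_injective ?_⟩
  rw [← Category.assoc, ← Iso.eq_comp_inv, Iso.inv_comp_eq] at hy
  rw [hy, Functor.map_sum, Preadditive.sum_comp, Preadditive.comp_sum]
  refine Finset.sum_congr rfl fun a _ => ?_
  rw [Functor.map_comp, hz, PreservesCoproduct.inv_hom, Category.assoc, Category.assoc,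
    ι_comp_sigmaComparison]

/-- Compatible approximations of `F` by compact objects can be chosen to form a sequence. -/
lemma exists_sequence_of_mem_closureCompacts {R : ℤ → Set C} (hR : Antitone R)
    (hK : ∀ K ∈ compacts (C := C), ∃ i₀ : ℤ, ∀ i ≥ i₀, ∀ D ∈ R i, ∀ f : K ⟶ D, f = 0)
    {F : C} (hF : F ∈ closureCompacts R) :
    ∃ (E : ℕ → C) (e : ∀ k : ℕ, E k ⟶ E (k + 1)) (π : ∀ k : ℕ, E k ⟶ F),
      (∀ k : ℕ, E k ∈ compacts) ∧
      (∀ k : ℕ, e k ≫ π (k + 1) = π k) ∧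
      (∀ k : ℕ, ∃ (D : C) (_ : D ∈ R ((k : ℤ) + 1)) (g : F ⟶ D) (h : D ⟶ (E k)⟦(1 : ℤ)⟧),
        Triangle.mk (π k) g h ∈ distTriang C) := by
  let A (k : ℕ) := {p : Σ E : C, (E ⟶ F) // p.1 ∈ compacts ∧
    ∃ (D : C) (_ : D ∈ R ((k : ℤ) + 1)) (g : F ⟶ D) (h : D ⟶ p.1⟦(1 : ℤ)⟧),
      Triangle.mk p.2 g h ∈ distTriang C}
  have hstep (k : ℕ) (a : A k) : ∃ (b : A (k + 1)) (e : a.1.1 ⟶ b.1.1), e ≫ b.1.2 = a.1.2 := by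
    obtain ⟨⟨X, p⟩, hX, -⟩ := a
    obtain ⟨i₀, hi₀⟩ := hK X hX
    obtain ⟨Y, D, hY, hD, f, g, h, hT⟩ := hF (max i₀ (((k + 1 : ℕ) : ℤ) + 1))
    obtain ⟨e, he⟩ : ∃ e : X ⟶ Y, p = e ≫ f :=
      Triangle.coyoneda_exact₂ _ hT p (hi₀ _ (le_max_left _ _) D hD _)
    exact ⟨⟨⟨Y, f⟩, hY, D, hR (le_max_right _ _) hD, g, h, hT⟩, e, he.symm⟩
  choose next e he using hstep
  have hzero : Nonempty (A 0) := by
    obtain ⟨Y, D, hY, hD, f, g, h, hT⟩ := hF (((0 : ℕ) : ℤ) + 1)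
    exact ⟨⟨⟨Y, f⟩, hY, D, hD, g, h, hT⟩⟩
  let seq : ∀ k, A k := fun k => Nat.rec hzero.some next k
  exact ⟨fun k => (seq k).1.1, fun k => e k (seq k), fun k => (seq k).1.2,
    fun k => (seq k).2.1, fun k => he k (seq k), fun k => (seq k).2.2⟩

variable [HasCoproducts.{0} C]

/-- A morphism from a compact object to a countable coproduct is a finite sum of morphisms to
the summands. -/
lemma exists_eq_sum_range_of_mem_compacts {K : C}
    (hK : K ∈ compacts) (E : ℕ → C) (x : K ⟶ ∐ E) :
    ∃ (N : ℕ) (y : ∀ k, K ⟶ E k), x = ∑ k ∈ Finset.range N, y k ≫ Sigma.ι E k := by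
  classical
  let up : (∐ E) ⟶ ∐ fun i : ULift.{v} ℕ => E i.down :=
    Sigma.desc fun k => Sigma.ι (fun i : ULift.{v} ℕ => E i.down) ⟨k⟩
  let down : (∐ fun i : ULift.{v} ℕ => E i.down) ⟶ ∐ E :=
    Sigma.desc fun i => Sigma.ι E i.down
  have hud : up ≫ down = 𝟙 _ := Sigma.hom_ext _ _ fun k => by simp [up, down]
  obtain ⟨s, y, hy⟩ := exists_eq_sum_of_mem_compacts hK _ (x ≫ up)
  let t : Finset ℕ := s.image ULift.down
  obtain ⟨N, hN⟩ := t.exists_nat_subset_range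
  refine ⟨N, fun k => if k ∈ t then y ⟨k⟩ else 0, ?_⟩
  have hx : x = ∑ i ∈ s, y i ≫ Sigma.ι E i.down := by
    rw [← Category.comp_id x, ← hud, ← Category.assoc, hy, Preadditive.sum_comp]
    exact Finset.sum_congr rfl fun i _ => by simp [down]
  rw [← Finset.sum_subset hN (fun k _ hk => by simp [hk])]
  rw [hx, Finset.sum_image fun _ _ _ _ h => ULift.down_injective h]
  refine Finset.sum_congr rfl fun i hi => ?_
  have hit : i.down ∈ t := Finset.mem_image_of_mem _ hi
  simp only [if_pos hit]

/-- The morphism `1 - shift` on the coproduct of a sequence. -/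
noncomputable abbrev oneSubShift {E : ℕ → C} (e : ∀ k, E k ⟶ E (k + 1)) : (∐ E) ⟶ ∐ E :=
  Sigma.desc (fun k => Sigma.ι E k - e k ≫ Sigma.ι E (k + 1))

lemma eq_zero_of_comp_oneSubShift {E : ℕ → C} (e : ∀ k, E k ⟶ E (k + 1)) {K : C}
    (hK : K ∈ compacts) (x : K ⟶ ∐ E) (hx : x ≫ oneSubShift e = 0) : x = 0 := by
  have h0 : oneSubShift e ≫ Sigma.π E 0 = Sigma.π E 0 := Sigma.hom_ext _ _ fun k => by
    simp [Preadditive.sub_comp, Sigma.ι_π_of_ne E (Nat.succ_ne_zero k)]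
  have hs (n : ℕ) : oneSubShift e ≫ Sigma.π E (n + 1) =
      Sigma.π E (n + 1) - Sigma.π E n ≫ e n := Sigma.hom_ext _ _ fun k => by
    rcases eq_or_ne k n with rfl | hkn
    · simp [Preadditive.sub_comp, Preadditive.comp_sub]
    · simp [Preadditive.sub_comp, Preadditive.comp_sub, Sigma.ι_π_of_ne_assoc E hkn,
        Sigma.ι_π_of_ne E (fun h => hkn (Nat.succ_injective h) : k + 1 ≠ n + 1)]
  have hπ (n : ℕ) : x ≫ Sigma.π E n = 0 := by
    induction n with
    | zero => rw [← h0, reassoc_of% hx, zero_comp]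
    | succ n ih =>
      have := hs n
      rw [eq_sub_iff_add_eq] at this
      rw [← this, Preadditive.comp_add, reassoc_of% hx, reassoc_of% ih, zero_comp, zero_comp,
        add_zero]
  obtain ⟨N, y, rfl⟩ := exists_eq_sum_range_of_mem_compacts hK E x
  refine Finset.sum_eq_zero fun k hk => ?_
  have := hπ k
  rw [Preadditive.sum_comp, Finset.sum_eq_single k] at this
  · simp only [Category.assoc, Sigma.ι_π_eq_id, Category.comp_id] at this
    rw [this, zero_comp]
  · intro b _ hb
    rw [Category.assoc, Sigma.ι_π_of_ne E hb, comp_zero]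
  · exact fun h => absurd hk h

/-- A morphism from a compact object to a homotopy colimit factors through arbitrarily late
stages of the sequence. -/
lemma exists_factor_hocolim {E : ℕ → C} (e : ∀ k, E k ⟶ E (k + 1)) {H : C} {ρ : (∐ E) ⟶ H}
    {δ : H ⟶ (∐ E)⟦(1 : ℤ)⟧} (hT : Triangle.mk (oneSubShift e) ρ δ ∈ distTriang C) {K : C}
    (hK : K ∈ compacts) (x : K ⟶ H) (m : ℕ) :
    ∃ (n : ℕ) (_ : m ≤ n) (y : K ⟶ E n), x = y ≫ Sigma.ι E n ≫ ρ := by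
  have hδ : δ ≫ (oneSubShift e)⟦(1 : ℤ)⟧' = 0 := comp_distTriang_mor_zero₃₁ _ hT
  have hρ : oneSubShift e ≫ ρ = 0 := comp_distTriang_mor_zero₁₂ _ hT
  have hι (k : ℕ) : Sigma.ι E k ≫ ρ = e k ≫ Sigma.ι E (k + 1) ≫ ρ := by
    have := Sigma.ι E k ≫= hρ
    rw [Sigma.ι_desc_assoc, comp_zero, Preadditive.sub_comp, sub_eq_zero, Category.assoc] at this
    exact this
  have hxδ : x ≫ δ = 0 := shift_hom_eq_zero (fun _ h => shift_mem_compacts h _) (oneSubShift e)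
    (fun _ h z hz => eq_zero_of_comp_oneSubShift e h z hz) hK _ (by
      rw [Category.assoc, hδ, comp_zero])
  obtain ⟨z, rfl⟩ : ∃ z : K ⟶ ∐ E, x = z ≫ ρ := Triangle.coyoneda_exact₃ _ hT x hxδ
  obtain ⟨N, y, rfl⟩ := exists_eq_sum_range_of_mem_compacts hK E z
  have hlate (n : ℕ) (w : K ⟶ E n) :
      ∃ (k : ℕ) (_ : m ≤ k) (y : K ⟶ E k), w ≫ Sigma.ι E n ≫ ρ = y ≫ Sigma.ι E k ≫ ρ := by
    have (j : ℕ) : ∃ y : K ⟶ E (n + j), w ≫ Sigma.ι E n ≫ ρ = y ≫ Sigma.ι E (n + j) ≫ ρ := by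
      induction j with
      | zero => exact ⟨w, rfl⟩
      | succ j ih =>
        obtain ⟨y, hy⟩ := ih
        exact ⟨y ≫ e (n + j), by rw [hy, hι, Category.assoc]; rfl⟩
    exact ⟨n + m, Nat.le_add_left _ _, this m⟩
  have hsum (N : ℕ) : ∃ w : K ⟶ E N,
      (∑ k ∈ Finset.range N, y k ≫ Sigma.ι E k) ≫ ρ = w ≫ Sigma.ι E N ≫ ρ := by
    induction N with
    | zero => exact ⟨0, by simp⟩
    | succ N ih =>
      obtain ⟨w, hw⟩ := ih
      refine ⟨(w + y N) ≫ e N, ?_⟩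
      rw [Finset.sum_range_succ, Preadditive.add_comp, hw, Category.assoc, ← Preadditive.add_comp,
        hι, Category.assoc]
  obtain ⟨w, hw⟩ := hsum N
  rw [hw]
  exact hlate N w

/-- Let `E` be a sequence of objects over `F` such that, for every compact `K`, the cone of
`E k ⟶ F` admits no nonzero morphism from `K` for `k ≫ 0`. In a compactly generated category, any
induced morphism from the homotopy colimit of `E` to `F` is an isomorphism. -/
lemma isIso_of_hocolim {S : Set C} (hS : S ⊆ compacts)
    (hgen : ∀ X : C, (∀ K ∈ S, ∀ n : ℤ, ∀ f : K⟦n⟧ ⟶ X, f = 0) → IsZero X)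
    {E : ℕ → C} (e : ∀ k, E k ⟶ E (k + 1)) {F : C} (π : ∀ k, E k ⟶ F)
    (D : ℕ → C) (g : ∀ k, F ⟶ D k) (h : ∀ k, D k ⟶ (E k)⟦(1 : ℤ)⟧)
    (hD : ∀ k, Triangle.mk (π k) (g k) (h k) ∈ distTriang C)
    (hK : ∀ K ∈ compacts (C := C), ∃ m : ℕ, ∀ k ≥ m, ∀ x : K ⟶ D k, x = 0)
    {H : C} {ρ : (∐ E) ⟶ H} {δ : H ⟶ (∐ E)⟦(1 : ℤ)⟧}
    (hT : Triangle.mk (oneSubShift e) ρ δ ∈ distTriang C)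
    (φ : H ⟶ F) (hφ : ∀ k, Sigma.ι E k ≫ ρ ≫ φ = π k) : IsIso φ := by
  have hinj : ∀ K ∈ compacts (C := C), ∀ x : K ⟶ H, x ≫ φ = 0 → x = 0 := by
    intro K hKc x hx
    obtain ⟨m, hm⟩ := hK _ (shift_mem_compacts hKc 1)
    obtain ⟨n, hn, y, rfl⟩ := exists_factor_hocolim e hT hKc x m
    rw [Category.assoc, Category.assoc, hφ] at hx
    obtain ⟨z, hz⟩ : ∃ z : K⟦(1 : ℤ)⟧ ⟶ D n, y⟦(1 : ℤ)⟧' = z ≫ h n :=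
      Triangle.coyoneda_exact₁ _ (hD n) (y⟦(1 : ℤ)⟧') (by
        change y⟦(1 : ℤ)⟧' ≫ (π n)⟦(1 : ℤ)⟧' = 0
        rw [← Functor.map_comp, hx, Functor.map_zero])
    rw [hm n hn z, zero_comp, Functor.map_eq_zero_iff] at hz
    rw [hz, zero_comp]
  have hsurj : ∀ K ∈ compacts (C := C), ∀ x : K ⟶ F, ∃ y : K ⟶ H, x = y ≫ φ := by
    intro K hKc x
    obtain ⟨m, hm⟩ := hK K hKc
    obtain ⟨y, hy⟩ : ∃ y : K ⟶ E m, x = y ≫ π m :=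
      Triangle.coyoneda_exact₂ _ (hD m) x (hm m le_rfl _)
    exact ⟨y ≫ Sigma.ι E m ≫ ρ, by rw [hy, Category.assoc, Category.assoc, hφ]⟩
  obtain ⟨Q, v, w, hQ⟩ := distinguished_cocone_triangle φ
  refine (Triangle.isZero₃_iff_isIso₁ _ hQ).1 (hgen Q fun K hKS n q => ?_)
  have hKc : K⟦n⟧ ∈ compacts := shift_mem_compacts (hS hKS) n
  have hwφ : w ≫ φ⟦(1 : ℤ)⟧' = 0 := comp_distTriang_mor_zero₃₁ _ hQ
  have hφv : φ ≫ v = 0 := comp_distTriang_mor_zero₁₂ _ hQ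
  have hqw : q ≫ w = 0 := shift_hom_eq_zero (fun _ h => shift_mem_compacts h _) φ hinj hKc _ (by
    rw [Category.assoc, hwφ, comp_zero])
  obtain ⟨r, rfl⟩ : ∃ r : K⟦n⟧ ⟶ F, q = r ≫ v := Triangle.coyoneda_exact₃ _ hQ q hqw
  obtain ⟨t, rfl⟩ := hsurj _ hKc r
  rw [Category.assoc, hφv, comp_zero]

end Coproducts

end Paper

namespace Paper

variable {C : Type u} [Category.{v} C] [HasZeroObject C] [Preadditive C]
  [HasShift C ℤ] [∀ n : ℤ, (CategoryTheory.shiftFunctor C n).Additive] [Pretriangulated C]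
  [HasCoproducts.{v} C] [HasCoproducts.{0} C]

/-- Let `T` be a compactly generated triangulated category with a generating sequence `𝒢` and an
orthogonal metric `R` on `T` such that for every `n`, `Hom(𝒢ⁿ, R_i) = 0` for all `i ≫ 0`.
Then `F` lies in the closure of compacts `T̄^c = ∩_n (T^c ⋆ R_n)` iff there is a sequence
`E_1 → E_2 → ⋯` of compact objects with compatible maps `E_n → F` such that
`Cone(E_n → F) ∈ R_n` for all `n`; moreover for any such sequence the induced map
`Hocolim E_n → F` is an isomorphism. -/
theorem statement_2
    (hCG : ∃ S : Set C, S ⊆ compacts ∧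
      ∀ X : C, (∀ K ∈ S, ∀ n : ℤ, ∀ f : K⟦n⟧ ⟶ X, f = 0) → IsZero X)
    (𝒢 : ℤ → Set C) (h𝒢 : IsGenSeq 𝒢)
    (R : ℤ → Set C) (hR : IsOrthogonalMetric R)
    (hvanish : ∀ n : ℤ, ∃ i₀ : ℤ, ∀ i ≥ i₀, ∀ X ∈ 𝒢 n, ∀ D ∈ R i, ∀ f : X ⟶ D, f = 0)
    (F : C) :
    (F ∈ closureCompacts R ↔
      ∃ (E : ℕ → C) (e : ∀ k : ℕ, E k ⟶ E (k + 1)) (π : ∀ k : ℕ, E k ⟶ F),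
        (∀ k : ℕ, E k ∈ compacts) ∧
        (∀ k : ℕ, e k ≫ π (k + 1) = π k) ∧
        (∀ k : ℕ, ∃ (D : C) (_ : D ∈ R ((k : ℤ) + 1)) (g : F ⟶ D) (h : D ⟶ (E k)⟦(1 : ℤ)⟧),
          Triangle.mk (π k) g h ∈ distTriang C)) ∧
    (∀ (E : ℕ → C) (e : ∀ k : ℕ, E k ⟶ E (k + 1)) (π : ∀ k : ℕ, E k ⟶ F),
      (∀ k : ℕ, E k ∈ compacts) →
      (∀ k : ℕ, e k ≫ π (k + 1) = π k) →
      (∀ k : ℕ, ∃ (D : C) (_ : D ∈ R ((k : ℤ) + 1)) (g : F ⟶ D) (h : D ⟶ (E k)⟦(1 : ℤ)⟧),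
        Triangle.mk (π k) g h ∈ distTriang C) →
      -- `H` together with the triangle `∐ E → ∐ E → H → Σ ∐ E` is a homotopy colimit of the
      -- sequence `E`, and `φ` is a map induced by the maps `π k : E k ⟶ F`;
      -- any such `φ` is an isomorphism
      ∀ (H : C) (ρ : (∐ E) ⟶ H) (δ : H ⟶ (∐ E)⟦(1 : ℤ)⟧),
        (Triangle.mk (Sigma.desc (fun k => Sigma.ι E k - e k ≫ Sigma.ι E (k + 1))) ρ δ
          ∈ distTriang C) →
        ∀ φ : H ⟶ F, (∀ k : ℕ, Sigma.ι E k ≫ ρ ≫ φ = π k) → IsIso φ) := by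
  have hanti : Antitone R := antitone_int_of_succ_le hR.1.antitone
  have hK : ∀ K ∈ compacts (C := C),
      ∃ i₀ : ℤ, ∀ i ≥ i₀, ∀ D ∈ R i, ∀ f : K ⟶ D, f = 0 := fun K hKc =>
    eventually_hom_eq_zero hvanish (h𝒢.generates.symm ▸ hKc : K ∈ seqInt 𝒢 Set.univ)
  refine ⟨⟨exists_sequence_of_mem_closureCompacts hanti hK, ?_⟩, ?_⟩
  · rintro ⟨E, e, π, hE, -, hπ⟩ n
    obtain ⟨D, hD, g, h, hT⟩ := hπ n.toNat
    exact ⟨E n.toNat, D, hE _, hanti (by lia) hD, π _, g, h, hT⟩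
  · intro E e π _ _ hπ H ρ δ hT φ hφ
    obtain ⟨S, hS, hgen⟩ := hCG
    choose D hD g h hDT using hπ
    refine isIso_of_hocolim hS hgen e π D g h hDT (fun K hKc => ?_) hT φ hφ
    obtain ⟨i₀, hi₀⟩ := hK K hKc
    exact ⟨i₀.toNat, fun k hk x => hi₀ _ (by lia) _ (hD k) x⟩

end Paper
end

section
/- Let T be a compactly generated triangulated category with an ℕ-compressed generating sequence 𝒢, and let ⟨W,V⟩ be a semiorthogonal decomposition of T^c. Then ⟨W^⊥ ∩ 𝒢^⊥, V^⊥ ∩ 𝒢^⊥⟩ is a semiorthogonal decomposition of 𝒢^⊥ := ∪_{n∈ℤ}(M^𝒢_n)^⊥, and moreover V^⊥ ∩ 𝒢^⊥ = Coprod(W) ∩ 𝒢^⊥. -/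
open CategoryTheory Limits Pretriangulated

universe v u

namespace Paper

section Retracts

variable {C : Type u} [Category.{v} C]

lemma essentiallySmall_smd (P : Set C) (hP : ObjectProperty.EssentiallySmall.{v} (C := C) P) :
    ObjectProperty.EssentiallySmall.{v} (C := C) (smd P) := by
  obtain ⟨P', _, hP⟩ := ObjectProperty.EssentiallySmall.exists_small_le'.{v} (C := C) P
  have : Small.{v} (Subtype P') := ‹ObjectProperty.Small.{v} P'›
  let J := Σ (A : Subtype P'), {p : A.1 ⟶ A.1 //
    ∃ (X : C) (i : X ⟶ A.1) (r : A.1 ⟶ X), i ≫ r = 𝟙 X ∧ r ≫ i = p}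
  let F : J → C := fun j => j.2.2.choose
  refine ⟨ObjectProperty.ofObj F, inferInstance, ?_⟩
  rintro X ⟨A, hA, i, r, hir⟩
  obtain ⟨A', hA', ⟨a⟩⟩ := hP _ hA
  let j : J := ⟨⟨A', hA'⟩, (a.inv ≫ r) ≫ (i ≫ a.hom), X, i ≫ a.hom, a.inv ≫ r, by simp [hir], rfl⟩
  obtain ⟨i', r', h₁, h₂⟩ := j.2.2.choose_spec
  have h₃ : r' ≫ i' = a.inv ≫ r ≫ i ≫ a.hom := by simp [h₂, j]
  refine ⟨F j, ⟨j⟩, ⟨⟨i ≫ a.hom ≫ r', i' ≫ a.inv ≫ r, ?_, ?_⟩⟩⟩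
  · simp [reassoc_of% h₃, hir]
  · have : i' ≫ a.inv ≫ r ≫ i ≫ a.hom ≫ r' = i' ≫ (r' ≫ i') ≫ r' := by simp [h₃]
    rw [Category.assoc, Category.assoc, this, Category.assoc, h₁, Category.comp_id]
    exact h₁

end Retracts

section Preadditive

variable {C : Type u} [Category.{v} C] [Preadditive C]

lemma rOrth_of_isZero (S : Set C) {X : C} (hX : IsZero X) : X ∈ rOrth S :=
  fun _ _ _ => hX.eq_of_tgt _ _

lemma rOrth_of_iso {S : Set C} {X Y : C} (e : X ≅ Y) (hX : X ∈ rOrth S) : Y ∈ rOrth S :=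
  fun A hA f => by
    rw [← cancel_mono e.inv, zero_comp]
    exact hX hA _

variable [HasShift C ℤ] [∀ n : ℤ, (CategoryTheory.shiftFunctor C n).Additive]

lemma shift_eq_zero_of_shift_neg {A X : C} (n : ℤ) (h : ∀ f : A⟦-n⟧ ⟶ X, f = 0)
    (f : A ⟶ X⟦n⟧) : f = 0 := by
  refine (shiftFunctor C (-n)).map_injective ?_
  rw [Functor.map_zero, ← cancel_mono ((shiftFunctorCompIsoId C n (-n) (by simp)).hom.app X),
    zero_comp]
  exact h _

lemma rOrth_shift {S S' : Set C} (n : ℤ) (hS : ∀ A ∈ S, A⟦-n⟧ ∈ S') {X : C}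
    (hX : X ∈ rOrth S') : X⟦n⟧ ∈ rOrth S :=
  fun A hA => shift_eq_zero_of_shift_neg n fun f => hX (hS A hA) f

lemma eq_zero_of_comp_shift_map {G Y Z : C} (n : ℤ) (k : Y ⟶ Z)
    (hk : ∀ d : G⟦-n⟧ ⟶ Y, d ≫ k = 0 → d = 0) (g : G ⟶ Y⟦n⟧) (hg : g ≫ k⟦n⟧' = 0) : g = 0 := by
  refine (shiftFunctor C (-n)).map_injective ?_
  rw [Functor.map_zero, ← cancel_mono ((shiftFunctorCompIsoId C n (-n) (by simp)).hom.app Y),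
    zero_comp]
  refine hk _ ?_
  have h := (shiftFunctorCompIsoId C n (-n) (by simp)).hom.naturality k
  dsimp at h
  rw [Category.assoc, ← h, ← Functor.map_comp_assoc, hg, Functor.map_zero, zero_comp]

end Preadditive

section Telescope

variable {C : Type u} [Category.{v} C] [Preadditive C] [HasCoproducts.{v} C]
  {w : ℕ → C} (t : ∀ n, w n ⟶ w (n + 1))

/-- The map `𝟙 - shift` on the coproduct of a sequence, whose cone is the homotopy colimit. -/
noncomputable def telescopeMap :
    (∐ fun n : ULift.{v} ℕ => w n.down) ⟶ ∐ fun n : ULift.{v} ℕ => w n.down :=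
  𝟙 _ - Limits.Sigma.desc fun n : ULift.{v} ℕ => t n.down ≫
    Sigma.ι (fun n : ULift.{v} ℕ => w n.down) ⟨n.down + 1⟩

lemma ι_telescopeMap (n : ℕ) :
    Sigma.ι (fun n : ULift.{v} ℕ => w n.down) ⟨n⟩ ≫ telescopeMap t =
      Sigma.ι (fun n : ULift.{v} ℕ => w n.down) ⟨n⟩ -
        t n ≫ Sigma.ι (fun n : ULift.{v} ℕ => w n.down) ⟨n + 1⟩ := by
  simp [telescopeMap, Preadditive.comp_sub]

lemma ι_telescopeMap_assoc (n : ℕ) {Z : C} (h : (∐ fun n : ULift.{v} ℕ => w n.down) ⟶ Z) :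
    Sigma.ι (fun n : ULift.{v} ℕ => w n.down) ⟨n⟩ ≫ telescopeMap t ≫ h =
      (Sigma.ι (fun n : ULift.{v} ℕ => w n.down) ⟨n⟩ -
        t n ≫ Sigma.ι (fun n : ULift.{v} ℕ => w n.down) ⟨n + 1⟩) ≫ h := by
  rw [← Category.assoc, ι_telescopeMap]

end Telescope

variable {C : Type u} [Category.{v} C] [HasZeroObject C] [Preadditive C]
  [HasShift C ℤ] [∀ n : ℤ, (CategoryTheory.shiftFunctor C n).Additive] [Pretriangulated C]

section Orthogonal

lemma rOrth_ext (S : Set C) {T : Triangle C} (hT : T ∈ distTriang C)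
    (h₁ : T.obj₁ ∈ rOrth S) (h₃ : T.obj₃ ∈ rOrth S) : T.obj₂ ∈ rOrth S :=
  fun A hA f => by
    obtain ⟨g, rfl⟩ := T.coyoneda_exact₂ hT f (h₃ hA _)
    rw [h₁ hA g, zero_comp]

lemma isTriangSub_rOrth {S : Set C} (hS : ∀ A ∈ S, ∀ n : ℤ, A⟦n⟧ ∈ S) :
    IsTriangSub (rOrth S) where
  zero _ hX := rOrth_of_isZero S hX
  isoClosed e hX := rOrth_of_iso e hX
  shift _ hX n := rOrth_shift n (fun A hA => hS A hA _) hX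
  ext _ hT h₁ h₃ := rOrth_ext S hT h₁ h₃

/-- A class of objects which is a triangulated subcategory, as an `ObjectProperty`. -/
lemma IsTriangSub.isTriangulated {P : ObjectProperty C} (hP : IsTriangSub (setOf P)) :
    P.IsTriangulated := by
  have : P.IsClosedUnderIsomorphisms := ⟨fun e hX => hP.isoClosed e hX⟩
  have : P.IsTriangulatedClosed₂ :=
    .mk' fun T hT h₁ h₃ => hP.ext T hT h₁ h₃
  have : P.ContainsZero := ⟨_, isZero_zero C, hP.zero _ (isZero_zero C)⟩
  have : P.IsStableUnderShift ℤ := ⟨fun n => ⟨fun X hX => hP.shift X hX n⟩⟩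
  constructor

lemma IsTriangSub.inter {S S' : Set C} (hS : IsTriangSub S) (hS' : IsTriangSub S') :
    IsTriangSub (S ∩ S') where
  zero X hX := ⟨hS.zero X hX, hS'.zero X hX⟩
  isoClosed e hX := ⟨hS.isoClosed e hX.1, hS'.isoClosed e hX.2⟩
  shift X hX n := ⟨hS.shift X hX.1 n, hS'.shift X hX.2 n⟩
  ext T hT h₁ h₃ := ⟨hS.ext T hT h₁.1 h₃.1, hS'.ext T hT h₁.2 h₃.2⟩

lemma IsTriangSub.triangClosure_subset {S S' : Set C} (hS : IsTriangSub S) (h : S' ⊆ S) :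
    setOf (triangClosure S') ⊆ S := by
  intro X hX
  induction hX with
  | of hX => exact h hX
  | zero hX => exact hS.zero _ hX
  | shift n _ ih => exact hS.shift _ ih n
  | ext hT _ _ ih₁ ih₃ => exact hS.ext _ hT ih₁ ih₃

/-- The objects all of whose shifts admit only zero morphisms to `X`. -/
lemma isTriangSub_hom_zero (X : C) :
    IsTriangSub {A : C | ∀ n : ℤ, ∀ f : A ⟶ X⟦n⟧, f = 0} where
  zero _ hA n f := hA.eq_of_src _ _
  isoClosed e hA n f := by
    rw [← cancel_epi e.hom, comp_zero]
    exact hA n _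
  shift A hA m n f := by
    refine (shiftFunctor C (-m)).map_injective ?_
    rw [Functor.map_zero, ← cancel_epi ((shiftFunctorCompIsoId C m (-m) (by simp)).inv.app A),
      ← cancel_mono (((shiftFunctorAdd' C n (-m) (n - m) (by ring)).app X).inv), comp_zero,
      zero_comp]
    exact hA (n - m) _
  ext T hT h₁ h₃ n f := by
    obtain ⟨g, rfl⟩ := T.yoneda_exact₂ hT f (h₁ n _)
    rw [h₃ n g, comp_zero]

end Orthogonal

section Smallness

lemma essentiallySmall_extensionProduct (P Q : ObjectProperty C)
    [ObjectProperty.EssentiallySmall.{v} P] [ObjectProperty.EssentiallySmall.{v} Q] :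
    ObjectProperty.EssentiallySmall.{v} (ObjectProperty.extensionProduct P Q) := by
  obtain ⟨P', _, hP⟩ := ObjectProperty.EssentiallySmall.exists_small_le'.{v} P
  obtain ⟨Q', _, hQ⟩ := ObjectProperty.EssentiallySmall.exists_small_le'.{v} Q
  let J := Σ (A : Subtype P') (B : Subtype Q'), (B.1 ⟶ A.1⟦(1 : ℤ)⟧)
  let F : J → C := fun j => (distinguished_cocone_triangle₂ j.2.2).choose
  have : Small.{v} (Subtype P') := ‹ObjectProperty.Small.{v} P'›
  have : Small.{v} (Subtype Q') := ‹ObjectProperty.Small.{v} Q'›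
  refine ⟨ObjectProperty.ofObj F, inferInstance, ?_⟩
  rintro X ⟨A, B, f, g, h, hT, hA, hB⟩
  obtain ⟨A', hA', ⟨a⟩⟩ := hP _ hA
  obtain ⟨B', hB', ⟨b⟩⟩ := hQ _ hB
  let j : J := ⟨⟨A', hA'⟩, ⟨B', hB'⟩, b.inv ≫ h ≫ a.hom⟦1⟧'⟩
  obtain ⟨f', g', hT'⟩ := (distinguished_cocone_triangle₂ j.2.2).choose_spec
  obtain ⟨e, -⟩ := exists_iso_of_arrow_iso _ _ (rot_of_distTriang _ (rot_of_distTriang _ hT))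
    (rot_of_distTriang _ (rot_of_distTriang _ hT'))
    (Arrow.isoMk b ((shiftFunctor C (1 : ℤ)).mapIso a) (b.hom_inv_id_assoc _))
  exact ⟨F j, ⟨j⟩, ⟨(shiftFunctor C (1 : ℤ)).preimageIso (Triangle.π₃.mapIso e)⟩⟩

/-- The objects obtained from `P` by at most `n` rounds of extensions. -/
def iterExt (P : ObjectProperty C) : ℕ → ObjectProperty C
  | 0 => P
  | n + 1 => iterExt P n ⊔ ObjectProperty.extensionProduct (iterExt P n) (iterExt P n)

lemma essentiallySmall_iterExt (P : ObjectProperty C) [ObjectProperty.EssentiallySmall.{v} P]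
    (n : ℕ) : ObjectProperty.EssentiallySmall.{v} (iterExt P n) := by
  induction n with
  | zero => assumption
  | succ n ih =>
    have := essentiallySmall_extensionProduct (iterExt P n) (iterExt P n)
    exact inferInstanceAs (ObjectProperty.EssentiallySmall.{v} (_ ⊔ _))

lemma monotone_iterExt (P : ObjectProperty C) : Monotone (iterExt P) :=
  monotone_nat_of_le_succ fun _ => le_sup_left

lemma essentiallySmall_coprodClosure (S : Set C) [Small.{v} S] :
    ObjectProperty.EssentiallySmall.{v} (C := C) (coprodClosure S) := by
  let S' : ObjectProperty C := fun X => X ∈ S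
  have hS : ObjectProperty.Small.{v} S' := ‹Small.{v} S›
  obtain ⟨Z, hZ⟩ := HasZeroObject.zero (C := C)
  let P : ObjectProperty C := S' ⊔ ObjectProperty.singleton Z
  have hP₀ : ObjectProperty.EssentiallySmall.{v} P :=
    inferInstanceAs (ObjectProperty.EssentiallySmall.{v} (S' ⊔ _))
  have hP (n : ℕ) : ObjectProperty.EssentiallySmall.{v} (iterExt P n) :=
    essentiallySmall_iterExt P n
  refine ObjectProperty.EssentiallySmall.of_le (Q := (⨆ n, iterExt P n).isoClosure) ?_
  intro X hX
  suffices ∃ n, (iterExt P n).isoClosure X by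
    obtain ⟨n, Y, hY, e⟩ := this
    exact ⟨Y, le_iSup (iterExt P) n _ hY, e⟩
  induction hX with
  | @of X hX => exact ⟨0, X, Or.inl hX, ⟨Iso.refl _⟩⟩
  | @zero X hX =>
    exact ⟨0, Z, Or.inr (by simp), ⟨hX.iso hZ⟩⟩
  | @ext T hT _ _ ih₁ ih₃ =>
    obtain ⟨n, hn⟩ := ih₁
    obtain ⟨m, hm⟩ := ih₃
    refine ⟨max n m + 1, ObjectProperty.monotone_isoClosure (le_sup_right :
      _ ≤ iterExt P (max n m + 1)) _ (ObjectProperty.le_isoClosure _ _ ?_)⟩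
    rw [← ObjectProperty.extensionProduct_isoClosure_left,
      ← ObjectProperty.extensionProduct_isoClosure_right]
    exact ⟨_, _, _, _, _, hT,
      ObjectProperty.monotone_isoClosure (monotone_iterExt P (le_max_left n m)) _ hn,
      ObjectProperty.monotone_isoClosure (monotone_iterExt P (le_max_right n m)) _ hm⟩

end Smallness

section Coproducts

variable [HasCoproducts.{v} C]

lemma IsCompactObj.exists_eq_sum {G : C} (hG : IsCompactObj G) {α : Type v} (f : α → C)
    (φ : G ⟶ ∐ f) : ∃ (s : Finset α) (ψ : ∀ a, G ⟶ f a), φ = ∑ a ∈ s, ψ a ≫ Sigma.ι f a := by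
  classical
  obtain ⟨s, ψ, rfl⟩ := hG f φ
  refine ⟨s, fun a => if h : a ∈ s then ψ ≫ Sigma.π (fun i : s => f i) ⟨a, h⟩ else 0, ?_⟩
  have hid : 𝟙 (∐ fun i : s => f i) =
      ∑ i : s, Sigma.π (fun i : s => f i) i ≫ Sigma.ι (fun i : s => f i) i := by
    refine Sigma.hom_ext _ _ fun j => ?_
    rw [Preadditive.comp_sum, Finset.sum_eq_single j]
    · simp
    · intro i _ hij
      rw [Sigma.ι_π_of_ne_assoc _ hij.symm, zero_comp]
    · simp
  rw [← Finset.sum_coe_sort]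
  conv_lhs => rw [← Category.id_comp (Sigma.desc _), hid]
  simp [Preadditive.sum_comp, Preadditive.comp_sum]

lemma bigClosure_of_iso {S : Set C} {X Y : C} (e : X ≅ Y) (hX : bigClosure S X) :
    bigClosure S Y := by
  obtain ⟨Z, hZ⟩ := HasZeroObject.zero (C := C)
  have hT : Triangle.mk e.hom (0 : Y ⟶ Z) 0 ∈ distTriang C :=
    (Triangle.distinguished_iff_of_isZero₃ _ hZ).2 (inferInstanceAs (IsIso e.hom))
  exact bigClosure.ext hT hX (.zero hZ)

lemma bigClosure_shift {S : Set C} (n : ℤ) (hS : ∀ X ∈ S, X⟦n⟧ ∈ S) {X : C}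
    (hX : bigClosure S X) : bigClosure S (X⟦n⟧) := by
  induction hX with
  | of hX => exact .of (hS _ hX)
  | zero hX => exact .zero ((shiftFunctor C n).map_isZero hX)
  | coprod f _ ih =>
    exact bigClosure_of_iso (PreservesCoproduct.iso (shiftFunctor C n) f).symm (.coprod _ ih)
  | ext hT _ _ ih₁ ih₃ => exact .ext (Triangle.shift_distinguished _ hT n) ih₁ ih₃

lemma bigClosure_cone {S : Set C} (hS : ∀ X ∈ S, X⟦(1 : ℤ)⟧ ∈ S) {T : Triangle C}
    (hT : T ∈ distTriang C) (h₁ : bigClosure S T.obj₁) (h₂ : bigClosure S T.obj₂) :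
    bigClosure S T.obj₃ :=
  .ext (rot_of_distTriang _ hT) h₂ (bigClosure_shift 1 hS h₁)

lemma eq_zero_of_mem_CoprodSet {S : Set C} {X E : C} (hX : X ∈ CoprodSet S) (hE : E ∈ rOrth S)
    (f : X ⟶ E) : f = 0 := by
  change bigClosure S X at hX
  induction hX with
  | of hX => exact hE hX f
  | zero hX => exact hX.eq_of_src _ _
  | coprod g _ ih =>
    refine Sigma.hom_ext _ _ fun a => ?_
    rw [ih a (Sigma.ι g a ≫ f), comp_zero]
  | @ext T hT _ _ ih₁ ih₃ =>
    obtain ⟨g, rfl⟩ := T.yoneda_exact₂ hT f (ih₁ _)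
    rw [ih₃ g, comp_zero]

lemma CoprodSet_subset_rOrth {S V : Set C} (hV : V ⊆ compacts) (hS : S ⊆ rOrth V) :
    CoprodSet S ⊆ rOrth V := by
  intro X hX
  change bigClosure S X at hX
  induction hX with
  | of hX => exact hS hX
  | zero hX => exact rOrth_of_isZero V hX
  | coprod g _ ih =>
    intro A hA φ
    obtain ⟨s, ψ, rfl⟩ := (hV hA).exists_eq_sum g φ
    exact Finset.sum_eq_zero fun a _ => by rw [ih a hA (ψ a), zero_comp]
  | ext hT _ _ ih₁ ih₃ => exact rOrth_ext V hT ih₁ ih₃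

section Telescope

variable {w : ℕ → C} (t : ∀ n, w n ⟶ w (n + 1))

lemma eq_zero_of_comp_telescopeMap {G : C} (hG : IsCompactObj G)
    (d : G ⟶ ∐ fun n : ULift.{v} ℕ => w n.down) (hd : d ≫ telescopeMap t = 0) : d = 0 := by
  classical
  let f : ULift.{v} ℕ → C := fun n => w n.down
  have hπ (n : ℕ) : d ≫ Sigma.π f ⟨n⟩ = 0 := by
    induction n with
    | zero =>
      have h : telescopeMap t ≫ Sigma.π f ⟨0⟩ = Sigma.π f ⟨0⟩ := by
        refine Sigma.hom_ext _ _ fun ⟨m⟩ => ?_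
        rw [ι_telescopeMap_assoc, Preadditive.sub_comp, Category.assoc,
          Sigma.ι_π_of_ne f (by simp : (⟨m + 1⟩ : ULift.{v} ℕ) ≠ ⟨0⟩), comp_zero, sub_zero]
      rw [← h, reassoc_of% hd, zero_comp]
    | succ n ih =>
      have h : telescopeMap t ≫ Sigma.π f ⟨n + 1⟩ =
          Sigma.π f ⟨n + 1⟩ - Sigma.π f ⟨n⟩ ≫ t n := by
        refine Sigma.hom_ext _ _ fun ⟨m⟩ => ?_
        rw [ι_telescopeMap_assoc, Preadditive.sub_comp, Category.assoc, Preadditive.comp_sub]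
        congr 1
        by_cases hm : m = n
        · subst hm
          simp [f]
        · rw [Sigma.ι_π_of_ne f (by simpa using hm : (⟨m + 1⟩ : ULift.{v} ℕ) ≠ ⟨n + 1⟩),
            Sigma.ι_π_of_ne_assoc f (by simpa using hm : (⟨m⟩ : ULift.{v} ℕ) ≠ ⟨n⟩),
            comp_zero, zero_comp]
      have h' : d ≫ telescopeMap t ≫ Sigma.π f ⟨n + 1⟩ = 0 := by rw [reassoc_of% hd, zero_comp]
      rwa [h, Preadditive.comp_sub, reassoc_of% ih, zero_comp, sub_zero] at h'
  obtain ⟨s, ψ, hψ⟩ := hG.exists_eq_sum f d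
  have hψ' (a) (ha : a ∈ s) : ψ a = 0 := by
    have := hπ a.down
    rw [hψ, Preadditive.sum_comp, Finset.sum_eq_single a] at this
    · simpa using this
    · intro b _ hb
      rw [Category.assoc, Sigma.ι_π_of_ne f hb, comp_zero]
    · exact fun h => (h ha).elim
  rw [hψ]
  exact Finset.sum_eq_zero fun a ha => by rw [hψ' a ha, zero_comp]

/-- A morphism from a compact object to a homotopy colimit factors through a finite stage. -/
lemma exists_factor_telescope {G h : C} (hG : IsCompactObj G) (hG' : IsCompactObj (G⟦(-1 : ℤ)⟧))
    (p : (∐ fun n : ULift.{v} ℕ => w n.down) ⟶ h)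
    (q : h ⟶ (∐ fun n : ULift.{v} ℕ => w n.down)⟦(1 : ℤ)⟧)
    (hT : Triangle.mk (telescopeMap t) p q ∈ distTriang C) (f : G ⟶ h) :
    ∃ (n : ℕ) (e : G ⟶ w n), f = e ≫ Sigma.ι (fun n : ULift.{v} ℕ => w n.down) ⟨n⟩ ≫ p := by
  classical
  have hstep (n : ℕ) : Sigma.ι (fun n : ULift.{v} ℕ => w n.down) ⟨n⟩ ≫ p =
      t n ≫ Sigma.ι (fun n : ULift.{v} ℕ => w n.down) ⟨n + 1⟩ ≫ p := by
    have : telescopeMap t ≫ p = 0 := comp_distTriang_mor_zero₁₂ _ hT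
    rw [← sub_eq_zero, ← Category.assoc (t n), ← Preadditive.sub_comp, ← ι_telescopeMap,
      Category.assoc, this, comp_zero]
  have hle {n m : ℕ} (hnm : n ≤ m) (e : G ⟶ w n) : ∃ e' : G ⟶ w m,
      e ≫ Sigma.ι (fun n : ULift.{v} ℕ => w n.down) ⟨n⟩ ≫ p =
        e' ≫ Sigma.ι (fun n : ULift.{v} ℕ => w n.down) ⟨m⟩ ≫ p := by
    induction m, hnm using Nat.le_induction with
    | base => exact ⟨e, rfl⟩
    | succ m _ ih =>
      obtain ⟨e', he'⟩ := ih
      exact ⟨e' ≫ t m, by rw [he', hstep, Category.assoc]⟩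
  have hfq : f ≫ q = 0 :=
    eq_zero_of_comp_shift_map 1 (telescopeMap t) (eq_zero_of_comp_telescopeMap t hG') _ (by
      have : q ≫ (telescopeMap t)⟦(1 : ℤ)⟧' = 0 := comp_distTriang_mor_zero₃₁ _ hT
      rw [Category.assoc, this, comp_zero])
  obtain ⟨d, rfl⟩ := Triangle.coyoneda_exact₃ _ hT f hfq
  obtain ⟨s, ψ, rfl⟩ := hG.exists_eq_sum _ d
  clear hfq
  change ∃ (n : ℕ) (e : G ⟶ w n), (∑ a ∈ s, _) ≫ p = _
  induction s using Finset.induction_on with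
  | empty => exact ⟨0, 0, by simp⟩
  | insert a s ha ih =>
    obtain ⟨n, e, he⟩ := ih
    obtain ⟨e₁, he₁⟩ := hle (le_max_left a.down n) (ψ a)
    obtain ⟨e₂, he₂⟩ := hle (le_max_right a.down n) e
    refine ⟨max a.down n, e₁ + e₂, ?_⟩
    rw [Finset.sum_insert ha, Preadditive.add_comp, he, he₂, Preadditive.add_comp, ← he₁,
      Category.assoc]

end Telescope

section Resolution

/-- Any morphism from `w` to `X` extends to a cone which kills all the morphisms from objects
of `A` to `w` that become zero in `X`. -/
lemma exists_kill {A : Set C} (hA : IsTriangSub A)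
    (hA' : ObjectProperty.EssentiallySmall.{v} (C := C) A) {w X : C} (hw : w ∈ CoprodSet A)
    (a : w ⟶ X) : ∃ w' ∈ CoprodSet A, ∃ (t : w ⟶ w') (a' : w' ⟶ X), t ≫ a' = a ∧
      ∀ G ∈ A, ∀ e : G ⟶ w, e ≫ a = 0 → e ≫ t = 0 := by
  obtain ⟨P', _, hPA, hP⟩ := ObjectProperty.EssentiallySmall.exists_small_le.{v} (C := C) A
  have : Small.{v} (Subtype P') := ‹ObjectProperty.Small.{v} P'›
  let J := Σ R : Subtype P', {e : R.1 ⟶ w // e ≫ a = 0}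
  let R : Shrink.{v} J → C := fun j => ((equivShrink J).symm j).1.1
  let d : ∐ R ⟶ w := Limits.Sigma.desc fun j => ((equivShrink J).symm j).2.1
  have hd : d ≫ a = 0 := Sigma.hom_ext _ _ fun j => by
    simpa [d] using ((equivShrink J).symm j).2.2
  obtain ⟨w', t, r, hT⟩ := distinguished_cocone_triangle d
  obtain ⟨a', ha'⟩ := Triangle.yoneda_exact₂ _ hT a hd
  refine ⟨w', bigClosure_cone (fun X hX => hA.shift X hX 1) hT
    (.coprod _ fun j => .of (hPA _ ((equivShrink J).symm j).1.2)) hw, t, a', ha'.symm, ?_⟩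
  intro G hG e he
  obtain ⟨G', hG', ⟨i⟩⟩ := hP _ hG
  let j : J := ⟨⟨G', hG'⟩, i.inv ≫ e, by rw [Category.assoc, he, comp_zero]⟩
  have hj : ∀ j : J, ∃ k : j.1.1 ⟶ ∐ R, k ≫ d = j.2.1 := fun j => by
    obtain ⟨j, rfl⟩ := (equivShrink J).symm.surjective j
    exact ⟨Sigma.ι R j, by simp [d]⟩
  obtain ⟨k, hk⟩ := hj j
  have hdt : d ≫ t = 0 := comp_distTriang_mor_zero₁₂ _ hT
  have hk' : k ≫ d = i.inv ≫ e := hk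
  rw [← i.hom_inv_id_assoc e, ← hk', Category.assoc, Category.assoc, hdt, comp_zero, comp_zero]

lemma exists_cover {A : Set C} (hA' : ObjectProperty.EssentiallySmall.{v} (C := C) A) (X : C) :
    ∃ w ∈ CoprodSet A, ∃ a : w ⟶ X, ∀ G ∈ A, ∀ f : G ⟶ X, ∃ e : G ⟶ w, e ≫ a = f := by
  obtain ⟨P', _, hPA, hP⟩ := ObjectProperty.EssentiallySmall.exists_small_le.{v} (C := C) A
  have : Small.{v} (Subtype P') := ‹ObjectProperty.Small.{v} P'›
  let J := Σ R : Subtype P', (R.1 ⟶ X)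
  let R : Shrink.{v} J → C := fun j => ((equivShrink J).symm j).1.1
  let d : ∐ R ⟶ X := Limits.Sigma.desc fun j => ((equivShrink J).symm j).2
  refine ⟨_, .coprod R fun j => .of (hPA _ ((equivShrink J).symm j).1.2), d, ?_⟩
  intro G hG f
  obtain ⟨G', hG', ⟨i⟩⟩ := hP _ hG
  have hj : ∀ j : J, ∃ k : j.1.1 ⟶ ∐ R, k ≫ d = j.2 := fun j => by
    obtain ⟨j, rfl⟩ := (equivShrink J).symm.surjective j
    exact ⟨Sigma.ι R j, by simp [d]⟩
  obtain ⟨k, hk⟩ := hj ⟨⟨G', hG'⟩, i.inv ≫ f⟩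
  have hk' : k ≫ d = i.inv ≫ f := hk
  exact ⟨i.hom ≫ k, by rw [Category.assoc, hk', i.hom_inv_id_assoc]⟩

/-- Bousfield localization at an essentially small triangulated subcategory of compact objects. -/
lemma exists_resolution {A : Set C} (hA : IsTriangSub A) (hAc : A ⊆ compacts)
    (hA' : ObjectProperty.EssentiallySmall.{v} (C := C) A) (X : C) :
    ∃ (w X' : C) (p : w ⟶ X) (q : X ⟶ X') (r : X' ⟶ w⟦(1 : ℤ)⟧),
      Triangle.mk p q r ∈ distTriang C ∧ w ∈ CoprodSet A ∧ X' ∈ rOrth A := by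
  let S := Σ' w : C, Σ' _ : w ∈ CoprodSet A, (w ⟶ X)
  have hstep (s : S) := exists_kill hA hA' s.2.1 s.2.2
  choose w' hw' t' a' hta hkill using hstep
  obtain ⟨w₀, hw₀, a₀, ha₀⟩ := exists_cover hA' X
  let s : ℕ → S := fun n => Nat.rec ⟨w₀, hw₀, a₀⟩ (fun _ s => ⟨w' s, hw' s, a' s⟩) n
  let w : ℕ → C := fun n => (s n).1
  let t : ∀ n, w n ⟶ w (n + 1) := fun n => t' (s n)
  let a : ∀ n, w n ⟶ X := fun n => (s n).2.2
  have hta (n) : t n ≫ a (n + 1) = a n := hta (s n)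
  have hkill (n) : ∀ G ∈ A, ∀ e : G ⟶ w n, e ≫ a n = 0 → e ≫ t n = 0 := hkill (s n)
  have hw : bigClosure A (∐ fun n : ULift.{v} ℕ => w n.down) :=
    .coprod _ fun n => (s n.down).2.1
  obtain ⟨h, p, q, hT⟩ := distinguished_cocone_triangle (telescopeMap t)
  have hh : h ∈ CoprodSet A := bigClosure_cone (fun X hX => hA.shift X hX 1) hT hw hw
  let b : (∐ fun n : ULift.{v} ℕ => w n.down) ⟶ X := Limits.Sigma.desc fun n => a n.down
  have hb : telescopeMap t ≫ b = 0 := Sigma.hom_ext _ _ fun ⟨n⟩ => by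
    rw [ι_telescopeMap_assoc, comp_zero, Preadditive.sub_comp, Category.assoc]
    simp [b, hta]
  obtain ⟨c, hc⟩ : ∃ c : h ⟶ X, b = p ≫ c := Triangle.yoneda_exact₂ _ hT b hb
  have hιc (n : ℕ) : Sigma.ι (fun n : ULift.{v} ℕ => w n.down) ⟨n⟩ ≫ p ≫ c = a n := by
    rw [← hc]
    simp [b]
  have hsurj (G) (hG : G ∈ A) (f : G ⟶ X) : ∃ e : G ⟶ h, e ≫ c = f := by
    obtain ⟨e, rfl⟩ := ha₀ G hG f
    exact ⟨e ≫ Sigma.ι (fun n : ULift.{v} ℕ => w n.down) ⟨0⟩ ≫ p, by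
      rw [Category.assoc, Category.assoc, hιc 0]
      rfl⟩
  have hTz : telescopeMap t ≫ p = 0 := comp_distTriang_mor_zero₁₂ _ hT
  have hinj (G) (hG : G ∈ A) (f : G ⟶ h) (hf : f ≫ c = 0) : f = 0 := by
    obtain ⟨n, e, rfl⟩ := exists_factor_telescope t (hAc hG) (hAc (hA.shift G hG (-1))) p q hT f
    rw [Category.assoc, Category.assoc, hιc n] at hf
    have h0 := ι_telescopeMap_assoc t n p
    rw [hTz, comp_zero, Preadditive.sub_comp, eq_comm, sub_eq_zero, Category.assoc] at h0
    rw [h0, ← Category.assoc, hkill n G hG e hf, zero_comp]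
  obtain ⟨X', y, z, hT'⟩ := distinguished_cocone_triangle c
  refine ⟨h, X', c, y, z, hT', hh, fun G hG f => ?_⟩
  have hzc : z ≫ c⟦(1 : ℤ)⟧' = 0 := comp_distTriang_mor_zero₃₁ _ hT'
  have hcy : c ≫ y = 0 := comp_distTriang_mor_zero₁₂ _ hT'
  have hfz : f ≫ z = 0 := eq_zero_of_comp_shift_map 1 c (hinj _ (hA.shift G hG (-1))) _ (by
    rw [Category.assoc, hzc, comp_zero])
  obtain ⟨g, rfl⟩ : ∃ g : G ⟶ X, f = g ≫ y := Triangle.coyoneda_exact₃ _ hT' f hfz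
  obtain ⟨e, rfl⟩ := hsurj G hG g
  rw [Category.assoc, hcy, comp_zero]

end Resolution

section Reflection

/-- The reflection onto the right orthogonal of an essentially small triangulated subcategory of
compact objects, as a triangulated endofunctor. -/
lemma exists_reflection {V : Set C} (hV : IsTriangSub V) (hVc : V ⊆ compacts)
    (hV' : ObjectProperty.EssentiallySmall.{v} (C := C) V) :
    ∃ (F : C ⥤ C) (_ : F.CommShift ℤ) (η : 𝟭 C ⟶ F), F.IsTriangulated ∧
      (∀ X, F.obj X ∈ rOrth V) ∧ ∀ X E, E ∈ rOrth V →
        Function.Bijective fun g : F.obj X ⟶ E => η.app X ≫ g := by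
  let P : ObjectProperty C := fun X => X ∈ rOrth V
  have hP : IsTriangSub (setOf P) := isTriangSub_rOrth hV.shift
  have : P.IsTriangulated := hP.isTriangulated
  choose w L p q r hT hw hL using exists_resolution hV hVc hV'
  have hbij (X E : C) (hE : E ∈ rOrth V) : Function.Bijective fun g : L X ⟶ E => q X ≫ g := by
    constructor
    · intro g g' h
      rw [← sub_eq_zero] at h ⊢
      rw [← Preadditive.comp_sub] at h
      obtain ⟨k, hk⟩ := Triangle.yoneda_exact₃ _ (hT X) (g - g') h
      have hk' : k = 0 :=
        eq_zero_of_mem_CoprodSet (bigClosure_shift 1 (fun X hX => hV.shift X hX 1) (hw X)) hE k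
      rw [hk, hk']
      exact comp_zero
    · intro f
      obtain ⟨k, hk⟩ := Triangle.yoneda_exact₂ _ (hT X) f (eq_zero_of_mem_CoprodSet (hw X) hE _)
      exact ⟨k, hk.symm⟩
  let e (X : C) (Y : P.FullSubcategory) :
      ((⟨L X, hL X⟩ : P.FullSubcategory) ⟶ Y) ≃ (X ⟶ P.ι.obj Y) :=
    P.fullyFaithfulι.homEquiv.trans (Equiv.ofBijective _ (hbij X Y.obj Y.property))
  let G : C ⥤ P.FullSubcategory := Adjunction.leftAdjointOfEquiv e fun X Y Y' g h => by
    exact (Category.assoc _ _ _).symm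
  let adj : G ⊣ P.ι := Adjunction.adjunctionOfEquivLeft e _
  let := adj.leftAdjointCommShift ℤ
  have := adj.commShift_of_rightAdjoint ℤ
  have := adj.isTriangulated_leftAdjoint
  refine ⟨G ⋙ P.ι, inferInstance, adj.unit, inferInstance, fun X => hL X, fun X E hE => ?_⟩
  have hη : adj.unit.app X = q X := by
    have h : adj.unit.app X = e X (G.obj X) (𝟙 _) :=
      Adjunction.adjunctionOfEquivLeft_unit_app e _ X
    exact h.trans (Category.comp_id (q X))
  rw [hη]
  exact hbij X E hE

end Reflection

end Coproducts

section GeneratingSequence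

lemma rOrth_smd_coprodClosure (S : Set C) : rOrth (smd (setOf (coprodClosure S))) = rOrth S := by
  ext X
  constructor
  · exact fun hX A hA => hX ⟨A, .of hA, 𝟙 A, 𝟙 A, Category.comp_id _⟩
  · rintro hX A ⟨B, hB, i, r, hir⟩ f
    rw [← Category.id_comp f, ← hir, Category.assoc]
    suffices ∀ g : B ⟶ X, g = 0 by rw [this (r ≫ f), comp_zero]
    clear hir i r f
    change coprodClosure S B at hB
    induction hB with
    | of hA => exact hX hA
    | zero hA => exact fun g => hA.eq_of_src _ _
    | @ext T hT _ _ ih₁ ih₃ =>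
      intro g
      obtain ⟨k, rfl⟩ := T.yoneda_exact₂ hT g (ih₁ _)
      rw [ih₃ k, comp_zero]

lemma coprodClosure_mono {S S' : Set C} (h : S ⊆ S') {X : C} (hX : coprodClosure S X) :
    coprodClosure S' X := by
  induction hX with
  | of hX => exact .of (h hX)
  | zero hX => exact .zero hX
  | ext hT _ _ ih₁ ih₃ => exact .ext hT ih₁ ih₃

lemma seqInt_mono (𝒢 : ℤ → Set C) {I J : Set ℤ} (h : I ⊆ J) : seqInt 𝒢 I ⊆ seqInt 𝒢 J := by
  rintro X ⟨Y, hY, i, r, hir⟩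
  exact ⟨Y, coprodClosure_mono (Set.biUnion_subset_biUnion_left h) hY, i, r, hir⟩

lemma rOrth_seqInt_mono (𝒢 : ℤ → Set C) {n m : ℤ} (h : n ≤ m) :
    rOrth (seqInt 𝒢 (Set.Iic (-n))) ⊆ rOrth (seqInt 𝒢 (Set.Iic (-m))) :=
  fun _ hX _ hA => hX (seqInt_mono 𝒢 (Set.Iic_subset_Iic.2 (by omega)) hA)

variable [HasCoproducts.{v} C] {𝒢 : ℤ → Set C}

lemma IsGenSeq.essentiallySmall_compacts (h𝒢 : IsGenSeq 𝒢) (hfin : ∀ n, (𝒢 n).Finite) :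
    ObjectProperty.EssentiallySmall.{v} (C := C) compacts := by
  rw [← h𝒢.generates]
  have : Countable ↥(⋃ i ∈ Set.univ, 𝒢 i) :=
    (Set.countable_univ.biUnion fun i _ => (hfin i).countable).to_subtype
  have : Small.{v} ↥(⋃ i ∈ Set.univ, 𝒢 i) := Countable.toSmall _
  exact essentiallySmall_smd _ (essentiallySmall_coprodClosure _)

lemma IsGenSeq.seqInt_subset_compacts (h𝒢 : IsGenSeq 𝒢) (I : Set ℤ) :
    seqInt 𝒢 I ⊆ compacts :=
  h𝒢.generates ▸ seqInt_mono 𝒢 (Set.subset_univ I)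

lemma IsGenSeq.rOrth_shift_succ (h𝒢 : IsGenSeq 𝒢) {s : ℤ} (hs : s = 1 ∨ s = -1) {n : ℤ} {X : C}
    (hX : X ∈ rOrth (seqInt 𝒢 (Set.Iic (-n)))) :
    X⟦s⟧ ∈ rOrth (seqInt 𝒢 (Set.Iic (-(n + 1)))) := by
  rw [seqInt, rOrth_smd_coprodClosure]
  refine rOrth_shift s (fun A hA => ?_) hX
  obtain ⟨i, hi, hA⟩ := Set.mem_iUnion₂.1 hA
  rw [Set.mem_Iic] at hi
  refine seqInt_mono 𝒢 (I := Set.Icc (i - 1) (i + 1)) (fun j hj => ?_) ?_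
  · rw [Set.mem_Icc] at hj
    rw [Set.mem_Iic]
    omega
  · obtain rfl | rfl := hs
    · exact h𝒢.shiftDown i A hA
    · exact h𝒢.shiftUp i A hA

lemma IsGenSeq.isTriangSub_iUnion_rOrth (h𝒢 : IsGenSeq 𝒢) :
    IsTriangSub (⋃ n : ℤ, rOrth (seqInt 𝒢 (Set.Iic (-n)))) where
  zero X hX := Set.mem_iUnion.2 ⟨0, rOrth_of_isZero _ hX⟩
  isoClosed e hX := by
    obtain ⟨n, hX⟩ := Set.mem_iUnion.1 hX
    exact Set.mem_iUnion.2 ⟨n, rOrth_of_iso e hX⟩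
  shift X hX m := by
    induction m using Int.induction_on with
    | zero =>
      obtain ⟨n, hX⟩ := Set.mem_iUnion.1 hX
      exact Set.mem_iUnion.2 ⟨n, rOrth_of_iso ((shiftFunctorZero C ℤ).symm.app X) hX⟩
    | succ m ih =>
      obtain ⟨n, hX⟩ := Set.mem_iUnion.1 ih
      exact Set.mem_iUnion.2 ⟨n + 1, rOrth_of_iso ((shiftFunctorAdd C (m : ℤ) 1).symm.app X)
        (h𝒢.rOrth_shift_succ (.inl rfl) hX)⟩
    | pred m ih =>
      obtain ⟨n, hX⟩ := Set.mem_iUnion.1 ih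
      exact Set.mem_iUnion.2 ⟨n + 1, rOrth_of_iso
        ((shiftFunctorAdd' C (-m : ℤ) (-1) (-m - 1) (by ring)).symm.app X)
        (h𝒢.rOrth_shift_succ (.inr rfl) hX)⟩
  ext T hT h₁ h₃ := by
    obtain ⟨n, h₁⟩ := Set.mem_iUnion.1 h₁
    obtain ⟨m, h₃⟩ := Set.mem_iUnion.1 h₃
    exact Set.mem_iUnion.2 ⟨max n m, rOrth_ext _ hT (rOrth_seqInt_mono 𝒢 (le_max_left n m) h₁)
      (rOrth_seqInt_mono 𝒢 (le_max_right n m) h₃)⟩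

end GeneratingSequence

section Semiorthogonal

variable [HasCoproducts.{v} C] {W V : Set C}

/-- The reflection onto `V^⊥` maps compact objects to `W`. -/
lemma IsSOD.reflection_mem (hWV : IsSOD (compacts (C := C)) W V) (F : C ⥤ C) [F.CommShift ℤ]
    [F.IsTriangulated] (η : 𝟭 C ⟶ F) (hF : ∀ X, F.obj X ∈ rOrth V)
    (hη : ∀ X E, E ∈ rOrth V → Function.Bijective fun g : F.obj X ⟶ E => η.app X ≫ g)
    {X : C} (hX : X ∈ compacts) : F.obj X ∈ W := by
  have hS : IsTriangSub {X : C | F.obj X ∈ W} :=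
    { zero := fun X hX => hWV.triangA.zero _ (F.map_isZero hX)
      isoClosed := fun e hX => hWV.triangA.isoClosed (F.mapIso e) hX
      shift := fun X hX n =>
        hWV.triangA.isoClosed ((F.commShiftIso n).symm.app X) (hWV.triangA.shift _ hX n)
      ext := fun T hT h₁ h₃ => hWV.triangA.ext _ (F.map_distinguished T hT) h₁ h₃ }
  rw [← hWV.generates] at hX
  refine hS.triangClosure_subset ?_ hX
  rintro X (hX | hX)
  · have hXV : X ∈ rOrth V := fun A hA => hWV.hom_zero A hA X hX
    obtain ⟨g, hg : η.app X ≫ g = 𝟙 X⟩ := (hη X X hXV).2 (𝟙 X)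
    have hg' : g ≫ η.app X = 𝟙 (F.obj X) := (hη X _ (hF X)).1 (by
      change η.app X ≫ g ≫ η.app X = η.app X ≫ 𝟙 _
      rw [← Category.assoc, hg, Category.comp_id]
      exact Category.id_comp (η.app X))
    exact hWV.triangA.isoClosed ⟨η.app X, g, hg, hg'⟩ hX
  · refine hWV.triangA.zero _ ((IsZero.iff_id_eq_zero _).2 ((hη X _ (hF X)).1 ?_))
    change η.app X ≫ 𝟙 _ = η.app X ≫ 0
    rw [comp_zero, Category.comp_id]
    exact hF X hX _

lemma IsSOD.rOrth_eq_CoprodSet (hWV : IsSOD (compacts (C := C)) W V)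
    (hW : ObjectProperty.EssentiallySmall.{v} (C := C) W)
    (hCG : ∃ S : Set C, S ⊆ compacts ∧
      ∀ X : C, (∀ K ∈ S, ∀ n : ℤ, ∀ f : K⟦n⟧ ⟶ X, f = 0) → IsZero X) :
    rOrth V = CoprodSet W := by
  have hWV' : CoprodSet W ⊆ rOrth V :=
    CoprodSet_subset_rOrth hWV.subsetB fun X hX A hA => hWV.hom_zero A hA X hX
  refine subset_antisymm (fun X hX => ?_) hWV'
  have hVt := isTriangSub_rOrth hWV.triangB.shift
  have hWt := isTriangSub_rOrth hWV.triangA.shift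
  obtain ⟨w, X', p, q, r, hT, hw, hX'⟩ :=
    exists_resolution hWV.triangA hWV.subsetA hW X
  have hX'V : X' ∈ rOrth V :=
    hVt.ext _ (rot_of_distTriang _ hT) hX (hVt.shift _ (hWV' hw) 1)
  have hK : compacts ⊆ {A : C | ∀ n : ℤ, ∀ f : A ⟶ X'⟦n⟧, f = 0} := by
    conv_lhs => rw [← hWV.generates]
    refine (isTriangSub_hom_zero X').triangClosure_subset ?_
    rintro A (hA | hA) n
    · exact hWt.shift _ hX' n hA
    · exact hVt.shift _ hX'V n hA
  obtain ⟨S, hS, hSgen⟩ := hCG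
  have hX'0 : IsZero X' := hSgen X' fun K hK' n f => by
    have h := (isTriangSub_hom_zero X').shift K (hK (hS hK')) n 0
    rw [← cancel_mono ((shiftFunctorZero C ℤ).inv.app X'), zero_comp]
    exact h _
  have : IsIso p := (Triangle.isZero₃_iff_isIso₁ _ hT).1 hX'0
  exact bigClosure_of_iso (asIso p) hw

/-- The `Coprod W`-part of an object orthogonal to `M i` is orthogonal to every class of compact
objects which the reflection onto `V^⊥` maps into `^⊥((M i)^⊥)`. -/
lemma IsSOD.mem_rOrth_of_reflection (hWV : IsSOD (compacts (C := C)) W V) (F : C ⥤ C)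
    [F.CommShift ℤ] [F.IsTriangulated] (η : 𝟭 C ⟶ F) (hF : ∀ X, F.obj X ∈ rOrth V)
    (hη : ∀ X E, E ∈ rOrth V → Function.Bijective fun g : F.obj X ⟶ E => η.app X ≫ g)
    {M M' : Set C} (hM' : M' ⊆ compacts) (hFM : ∀ A ∈ M', F.obj A ∈ lOrth (rOrth M))
    {T : Triangle C} (hT : T ∈ distTriang C) (h₁ : T.obj₁ ∈ rOrth V) (h₂ : T.obj₂ ∈ rOrth M)
    (h₃ : T.obj₃ ∈ rOrth W) : T.obj₁ ∈ rOrth M' := by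
  intro A hA f
  obtain ⟨g, rfl⟩ := (hη A _ h₁).2 f
  obtain ⟨k, hk⟩ : ∃ k : F.obj A ⟶ T.obj₃⟦(-1 : ℤ)⟧, g = k ≫ T.invRotate.mor₁ :=
    Triangle.coyoneda_exact₂ _ (inv_rot_of_distTriang _ hT) g (hFM A hA h₂ (g ≫ T.mor₁))
  have hk' : k = 0 := (isTriangSub_rOrth hWV.triangA.shift).shift _ h₃ (-1)
    (hWV.reflection_mem F η hF hη (hM' hA)) k
  change η.app A ≫ g = 0
  have hg : g = 0 := by
    rw [hk, hk']
    exact zero_comp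
  rw [hg]
  exact comp_zero

end Semiorthogonal

end Paper

namespace Paper

variable {C : Type u} [Category.{v} C] [HasZeroObject C] [Preadditive C]
  [HasShift C ℤ] [∀ n : ℤ, (CategoryTheory.shiftFunctor C n).Additive] [Pretriangulated C]
  [HasCoproducts.{v} C]

/-- Let `T` be a compactly generated triangulated category with an `ℕ`-compressed generating
sequence `𝒢`, and let `⟨W,V⟩` be a semiorthogonal decomposition of `T^c`. Then
`⟨W^⊥ ∩ 𝒢^⊥, V^⊥ ∩ 𝒢^⊥⟩` is a semiorthogonal decomposition of
`𝒢^⊥ = ∪_{n∈ℤ} (M^𝒢_n)^⊥`, and `V^⊥ ∩ 𝒢^⊥ = Coprod(W) ∩ 𝒢^⊥`.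
(Triangulated endofunctors of `T^c` are encoded as triangulated endofunctors of `T`
preserving compact objects.) -/
theorem statement_8
    (hCG : ∃ S : Set C, S ⊆ compacts ∧
      ∀ X : C, (∀ K ∈ S, ∀ n : ℤ, ∀ f : K⟦n⟧ ⟶ X, f = 0) → IsZero X)
    (𝒢 : ℤ → Set C) (h𝒢 : IsGenSeq 𝒢) (hfin : ∀ n : ℤ, (𝒢 n).Finite)
    (hNcompressed : ∀ (F : C ⥤ C) [F.CommShift ℤ] [F.IsTriangulated],
      (∀ X ∈ compacts (C := C), F.obj X ∈ compacts (C := C)) →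
      ∃ l : ℕ, ∀ i : ℤ, ∀ X ∈ lOrth (rOrth (seqInt 𝒢 (Set.Iic (-(i + l))))) ∩ compacts,
        F.obj X ∈ lOrth (rOrth (seqInt 𝒢 (Set.Iic (-i)))) ∩ compacts)
    (hequiv : ∀ i : ℤ, ∃ j : ℕ,
      seqInt 𝒢 (Set.Iic (-(i + j))) ⊆ lOrth (rOrth (seqInt 𝒢 (Set.Iic (-i)))) ∩ compacts ∧
      lOrth (rOrth (seqInt 𝒢 (Set.Iic (-i)))) ∩ compacts ⊆ seqInt 𝒢 (Set.Iic (-(i - j))))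
    (W V : Set C) (hWV : IsSOD (compacts (C := C)) W V)
    (Gperp : Set C) (hGperp : Gperp = ⋃ n : ℤ, rOrth (seqInt 𝒢 (Set.Iic (-n)))) :
    IsSOD Gperp (rOrth W ∩ Gperp) (rOrth V ∩ Gperp) ∧
    rOrth V ∩ Gperp = CoprodSet W ∩ Gperp := by
  have hK := h𝒢.essentiallySmall_compacts hfin
  have hW : ObjectProperty.EssentiallySmall.{v} (C := C) W := .of_le hWV.subsetA
  have hV : ObjectProperty.EssentiallySmall.{v} (C := C) V := .of_le hWV.subsetB
  have hVW : rOrth V = CoprodSet W := hWV.rOrth_eq_CoprodSet hW hCG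
  have hG : IsTriangSub Gperp := hGperp ▸ h𝒢.isTriangSub_iUnion_rOrth
  have htA := (isTriangSub_rOrth hWV.triangA.shift).inter hG
  have htB := (isTriangSub_rOrth hWV.triangB.shift).inter hG
  refine ⟨⟨Set.inter_subset_right, Set.inter_subset_right, htA, htB, ?_, ?_⟩, by rw [hVW]⟩
  · rintro b ⟨hb, -⟩ a ⟨ha, -⟩ f
    exact eq_zero_of_mem_CoprodSet (hVW ▸ hb) ha f
  · refine subset_antisymm (hG.triangClosure_subset
      (Set.union_subset Set.inter_subset_right Set.inter_subset_right)) fun X hX => ?_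
    obtain ⟨w, X', p, q, r, hT, hw, hX'⟩ :=
      exists_resolution hWV.triangA hWV.subsetA hW X
    have hwV : w ∈ rOrth V := hVW ▸ hw
    have hwG : w ∈ Gperp := by
      obtain ⟨F, _, η, _, hF, hη⟩ := exists_reflection hWV.triangB hWV.subsetB hV
      obtain ⟨l, hl⟩ := hNcompressed F fun X hX =>
        hWV.subsetA (hWV.reflection_mem F η hF hη hX)
      rw [hGperp] at hX ⊢
      obtain ⟨i, hi⟩ := Set.mem_iUnion.1 hX
      have hc := h𝒢.seqInt_subset_compacts (Set.Iic (-(i + l)))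
      exact Set.mem_iUnion.2 ⟨i + l, hWV.mem_rOrth_of_reflection F η hF hη hc
        (fun A hA => (hl i A ⟨fun Y hY f => hY hA f, hc hA⟩).1) hT hwV hi hX'⟩
    have hX'G : X' ∈ Gperp := hG.ext _ (rot_of_distTriang _ hT) hX (hG.shift _ hwG 1)
    exact .ext hT (.of (.inr ⟨hwV, hwG⟩)) (.of (.inl ⟨hX', hX'G⟩))

end Paper
end
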